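/- arXiv:1204.5220 — 2 statements merged into one kernel-verified Lean document; each statement's English description precedes it below -/
import Mathlib

section
/- Let α > 0, let u ∈ L¹(T²) and let N_n ∈ ℕ be a sequence with N_n → ∞. Then there exists a sequence u_n ∈ L¹(T²) such that u_n → u in L¹(T²) and limsup_{n→∞} h_{N_n}^α(u_n) ≤ h_{∞,0}(u). -/
open MeasureTheory Filter Topology ENNReal
open scoped Classical

noncomputable section

/-- Fundamental domain of the flat unit torus `T²`, identified with `[0,1)²`. -/
def Q2 : Set (ℝ × ℝ) := Set.Ico (0:ℝ) 1 ×ˢ Set.Ico (0:ℝ) 1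

/-- Lebesgue measure on the torus, realized as Lebesgue measure on the fundamental domain. -/
def μT : Measure (ℝ × ℝ) := volume.restrict Q2

/-- A function on `ℝ²` represents a function on the torus `T²` iff it is `1`-periodic in
each coordinate. -/
def Periodic2 {E : Type*} (f : ℝ × ℝ → E) : Prop :=
  ∀ x : ℝ × ℝ, f (x.1 + 1, x.2) = f x ∧ f (x.1, x.2 + 1) = f x

/-- The index of the grid square (of the `N × N` grid) a real number's fractional part lies in. -/
def gridIdx (N : ℕ) (t : ℝ) : ℕ := (⌊Int.fract t * N⌋).toNat

/-- The piecewise constant (on the squares `S_N^{i,j}`) extension of grid values `g` to the torus. -/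
def extendGrid (N : ℕ) (g : ℕ → ℕ → ℝ) : ℝ × ℝ → ℝ :=
  fun x => g (gridIdx N x.1) (gridIdx N x.2)

/-- `g` represents `u ∈ A_N`: `u` agrees a.e. with the piecewise constant extension of `g`. -/
def RepGrid (N : ℕ) (u : ℝ × ℝ → ℝ) (g : ℕ → ℕ → ℝ) : Prop :=
  u =ᵐ[μT] extendGrid N g

/-- Binary ({0,1}-valued) grid functions. -/
def IsBinaryGrid (N : ℕ) (g : ℕ → ℕ → ℝ) : Prop :=
  ∀ i < N, ∀ j < N, g i j = 0 ∨ g i j = 1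

/-- Convergence in `L¹(T²)`. -/
def TendstoL1 (U : ℕ → ℝ × ℝ → ℝ) (u : ℝ × ℝ → ℝ) : Prop :=
  Tendsto (fun n => ∫⁻ x, ENNReal.ofReal |U n x - u x| ∂μT) atTop (nhds 0)

/-- The divergence of a vector field on `ℝ²`. -/
def div2 (v : ℝ × ℝ → ℝ × ℝ) (x : ℝ × ℝ) : ℝ :=
  (fderiv ℝ v x (1, 0)).1 + (fderiv ℝ v x (0, 1)).2

/-- The (isotropic) total variation `∫_{T²} |∇u|` of `u ∈ L¹(T²)`, as supremum over `C¹`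
periodic vector fields with Euclidean norm at most 1. -/
def isoTV (u : ℝ × ℝ → ℝ) : ℝ≥0∞ :=
  ⨆ (v : ℝ × ℝ → ℝ × ℝ) (_ : ContDiff ℝ 1 v ∧ Periodic2 v ∧
      ∀ x, (v x).1 ^ 2 + (v x).2 ^ 2 ≤ 1),
    ENNReal.ofReal (∫ x, u x * div2 v x ∂μT)

/-- The anisotropic total variation `∫_{T²} |u_x| + |u_y|`, as supremum over `C¹` periodic
vector fields with max-norm at most 1. -/
def anisoTV (u : ℝ × ℝ → ℝ) : ℝ≥0∞ :=
  ⨆ (v : ℝ × ℝ → ℝ × ℝ) (_ : ContDiff ℝ 1 v ∧ Periodic2 v ∧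
      ∀ x, |(v x).1| ≤ 1 ∧ |(v x).2| ≤ 1),
    ENNReal.ofReal (∫ x, u x * div2 v x ∂μT)

/-- `u ∈ BV(T²; {0,1})`: `u` takes values in `{0,1}` a.e. and has finite total variation. -/
def BV01 (u : ℝ × ℝ → ℝ) : Prop :=
  AEStronglyMeasurable u μT ∧ (∀ᵐ x ∂μT, u x = 0 ∨ u x = 1) ∧ isoTV u < ⊤

/-- The grid cut energy of `h_{N,0}`. -/
def hEnergy (N : ℕ) (g : ℕ → ℕ → ℝ) : ℝ :=
  (N : ℝ)⁻¹ * ∑ i ∈ Finset.range N, ∑ j ∈ Finset.range N,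
    (|g ((i + 1) % N) j - g i j| + |g i ((j + 1) % N) - g i j|)

/-- The functional `h_{N,0} : L¹(T²) → [0,∞]`. -/
def hN0 (N : ℕ) (u : ℝ × ℝ → ℝ) : ℝ≥0∞ :=
  ⨅ (g : ℕ → ℕ → ℝ) (_ : RepGrid N u g ∧ IsBinaryGrid N g), ENNReal.ofReal (hEnergy N g)

/-- The limit functional `h_{∞,0}`: the anisotropic total variation on `BV(T²;{0,1})`,
`+∞` otherwise. -/
def hInf0 (u : ℝ × ℝ → ℝ) : ℝ≥0∞ := if BV01 u then anisoTV u else ⊤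

/-- The standing assumptions on the double well potential `W`: `C²`, nonnegative,
vanishing exactly at `0` and `1`. -/
def DoubleWell (W : ℝ → ℝ) : Prop :=
  ContDiff ℝ 2 W ∧ (∀ s, 0 ≤ W s) ∧ ∀ s, W s = 0 ↔ s = 0 ∨ s = 1

/-- Assumption `(W1)` with exponent `β`: `W` is strictly smaller on neighborhoods
`Î₀ = (a₀,b₀) ∋ 0`, `Î₁ = (a₁,b₁) ∋ 1` of its wells than outside, and has polynomial
lower bounds of order `β` near the wells. -/
def CondW1 (W : ℝ → ℝ) (β : ℝ) : Prop :=
  ∃ a₀ b₀ a₁ b₁ : ℝ, a₀ < 0 ∧ 0 < b₀ ∧ a₁ < 1 ∧ 1 < b₁ ∧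
    Disjoint (Set.Ioo a₀ b₀) (Set.Ioo a₁ b₁) ∧
    (∀ s ∈ Set.Ioo a₀ b₀ ∪ Set.Ioo a₁ b₁, ∀ t ∉ Set.Ioo a₀ b₀ ∪ Set.Ioo a₁ b₁, W s < W t) ∧
    (∃ c₀ > (0:ℝ), ∀ s ∈ Set.Ioo a₀ b₀, c₀ * |s| ^ β ≤ W s) ∧
    (∃ c₁ > (0:ℝ), ∀ s ∈ Set.Ioo a₁ b₁, c₁ * |s - 1| ^ β ≤ W s)

/-- The grid energy of `h_N^α`. -/
def hAlphaEnergy (W : ℝ → ℝ) (α : ℝ) (N : ℕ) (g : ℕ → ℕ → ℝ) : ℝ :=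
  (N : ℝ)⁻¹ * ∑ i ∈ Finset.range N, ∑ j ∈ Finset.range N,
      ((g ((i + 1) % N) j - g i j) ^ 2 + (g i ((j + 1) % N) - g i j) ^ 2)
    + (N : ℝ) ^ α * ∑ i ∈ Finset.range N, ∑ j ∈ Finset.range N, W (g i j)

/-- The functional `h_N^α : L¹(T²) → [0,∞]` (finite exactly on `A_N`). -/
def hNalpha (W : ℝ → ℝ) (α : ℝ) (N : ℕ) (u : ℝ × ℝ → ℝ) : ℝ≥0∞ :=
  ⨅ (g : ℕ → ℕ → ℝ) (_ : RepGrid N u g), ENNReal.ofReal (hAlphaEnergy W α N g)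

/-! ### Translations and scalings of the torus -/

instance : IsProbabilityMeasure (volume.restrict (Set.Ico (0 : ℝ) 1)) :=
  ⟨by simp⟩

theorem μT_eq_prod :
    μT = (volume.restrict (Set.Ico (0 : ℝ) 1)).prod (volume.restrict (Set.Ico (0 : ℝ) 1)) := by
  rw [μT, Q2, Measure.prod_restrict, Measure.volume_eq_prod]

instance : IsProbabilityMeasure μT := by
  rw [μT_eq_prod]; infer_instance

theorem measurableSet_Q2 : MeasurableSet Q2 := measurableSet_Ico.prod measurableSet_Ico

/-- The representative in `Q2` of a point of the torus. -/
def wrap (x : ℝ × ℝ) : ℝ × ℝ := (Int.fract x.1, Int.fract x.2)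

theorem measurable_wrap : Measurable wrap :=
  (measurable_fract.comp measurable_fst).prodMk (measurable_fract.comp measurable_snd)

theorem wrap_eq_self {x : ℝ × ℝ} (hx : x ∈ Q2) : wrap x = x :=
  Prod.ext (Int.fract_eq_self.2 hx.1) (Int.fract_eq_self.2 hx.2)

theorem periodic2_comp_wrap {E : Type*} (f : ℝ × ℝ → E) : Periodic2 (f ∘ wrap) := fun x => by
  simp [wrap]

theorem Periodic2.add_intCast {E : Type*} {f : ℝ × ℝ → E} (hf : Periodic2 f) (x : ℝ × ℝ)
    (m n : ℤ) : f (x.1 + m, x.2 + n) = f x := by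
  have h1 : Function.Periodic (fun t => f (t, x.2 + n)) 1 := fun t => (hf (t, x.2 + n)).1
  have h2 : Function.Periodic (fun t => f (x.1, t)) 1 := fun t => (hf (x.1, t)).2
  have h3 := h1.int_mul m x.1
  have h4 := h2.int_mul n x.2
  simp only [mul_one] at h3 h4
  rw [h3, h4]

theorem Periodic2.apply_wrap {E : Type*} {f : ℝ × ℝ → E} (hf : Periodic2 f) (x : ℝ × ℝ) :
    f (wrap x) = f x := by
  rw [← hf.add_intCast (wrap x) ⌊x.1⌋ ⌊x.2⌋]
  simp [wrap, Int.fract_add_floor]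

theorem Periodic2.comp_add {E : Type*} {f : ℝ × ℝ → E} (hf : Periodic2 f) (z : ℝ × ℝ) :
    Periodic2 fun x => f (x + z) := fun x => by
  have h1 := (hf (x + z)).1
  have h2 := (hf (x + z)).2
  constructor
  · refine (congrArg f (Prod.ext ?_ ?_)).trans h1 <;> simp only [Prod.fst_add, Prod.snd_add]; ring
  · refine (congrArg f (Prod.ext ?_ ?_)).trans h2 <;> simp only [Prod.fst_add, Prod.snd_add]; ring

theorem measurePreserving_fract_add (z : ℝ) :
    MeasurePreserving (fun t : ℝ => Int.fract (t + z)) (volume.restrict (Set.Ico 0 1))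
      (volume.restrict (Set.Ico 0 1)) := by
  have hm : Measurable fun t : ℝ => Int.fract (t + z) :=
    measurable_fract.comp (measurable_id.add_const z)
  refine ⟨hm, Measure.ext fun s hs => ?_⟩
  have := Measure.isProbabilityMeasure_map (μ := volume.restrict (Set.Ico (0 : ℝ) 1)) hm.aemeasurable
  rw [← measureReal_eq_measureReal_iff, ← integral_indicator_one hs, ← integral_indicator_one hs,
    integral_map hm.aemeasurable
      ((measurable_one.indicator hs).aestronglyMeasurable)]
  have hp : Function.Periodic (fun t : ℝ => s.indicator (1 : ℝ → ℝ) (Int.fract t)) 1 := fun t => by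
    simp
  have h := hp.intervalIntegral_add_eq z 0
  have h0 : ∀ f : ℝ → ℝ, ∫ t in Set.Ico (0 : ℝ) 1, f t = ∫ t in (0 : ℝ)..1, f t := fun f => by
    rw [intervalIntegral.integral_of_le zero_le_one, integral_Ico_eq_integral_Ioc]
  rw [h0, h0, intervalIntegral.integral_comp_add_right
    (fun t => s.indicator (1 : ℝ → ℝ) (Int.fract t)) z, zero_add, add_comm (1 : ℝ), h, zero_add,
    ← h0, ← h0]
  refine setIntegral_congr_fun measurableSet_Ico fun t ht => ?_
  simp only [Int.fract_eq_self.2 ht]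

theorem measurePreserving_wrap_add (z : ℝ × ℝ) :
    MeasurePreserving (fun x => wrap (x + z)) μT μT := by
  rw [μT_eq_prod]
  exact (measurePreserving_fract_add z.1).prod (measurePreserving_fract_add z.2)

theorem Periodic2.lintegral_comp_add {f : ℝ × ℝ → ℝ≥0∞} (hf : Periodic2 f) (hm : Measurable f)
    (z : ℝ × ℝ) : ∫⁻ x, f (x + z) ∂μT = ∫⁻ x, f x ∂μT := by
  rw [← (measurePreserving_wrap_add z).lintegral_comp hm]
  simp_rw [hf.apply_wrap]

theorem Periodic2.integral_comp_add {f : ℝ × ℝ → ℝ} (hf : Periodic2 f) (hm : Measurable f)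
    (z : ℝ × ℝ) : ∫ x, f (x + z) ∂μT = ∫ x, f x ∂μT := by
  rw [← (measurePreserving_wrap_add z).map_eq, integral_map
    (measurePreserving_wrap_add z).measurable.aemeasurable hm.aestronglyMeasurable,
    (measurePreserving_wrap_add z).map_eq]
  simp_rw [hf.apply_wrap]

theorem lintegral_Ico_comp_div {N : ℕ} (hN : N ≠ 0) (f : ℝ → ℝ≥0∞) (k : ℕ) :
    ∫⁻ a in Set.Ico (0 : ℝ) 1, f ((k + a) / N) =
      N * ∫⁻ t in Set.Ico ((k : ℝ) / N) ((k + 1) / N), f t := by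
  have hN' : (0 : ℝ) < N := by positivity
  have hemb : MeasurableEmbedding fun t : ℝ => (N : ℝ) * t - k :=
    (measurableEmbedding_subRight (k : ℝ)).comp (measurableEmbedding_mulLeft₀ hN'.ne')
  have hmap : Measure.map (fun t : ℝ => (N : ℝ) * t - k) volume = ENNReal.ofReal (N : ℝ)⁻¹ • volume := by
    change Measure.map ((fun t => t - (k : ℝ)) ∘ (fun t => (N : ℝ) * t)) volume = _
    rw [← Measure.map_map (by fun_prop)
      (by fun_prop), Real.map_volume_mul_left hN'.ne', Measure.map_smul, map_sub_right_eq_self,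
      abs_of_pos (by positivity)]
  have hpre : (fun t : ℝ => (N : ℝ) * t - k) ⁻¹' Set.Ico 0 1 =
      Set.Ico ((k : ℝ) / N) ((k + 1) / N) := by
    ext t
    simp only [Set.mem_preimage, Set.mem_Ico, div_le_iff₀ hN', lt_div_iff₀ hN']
    constructor <;> rintro ⟨h1, h2⟩ <;> constructor <;> linarith
  have h := hemb.lintegral_map (fun a => f ((k + a) / N))
    (μ := volume.restrict (Set.Ico ((k : ℝ) / N) ((k + 1) / N)))
  rw [← hpre, ← hemb.restrict_map, hmap, hpre, Measure.restrict_smul, lintegral_smul_measure] at h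
  have h2 : ∀ t : ℝ, ((k : ℝ) + (N * t - k)) / N = t := fun t => by field_simp; ring
  simp_rw [h2] at h
  rw [← h, ENNReal.ofReal_inv_of_pos hN', ENNReal.ofReal_natCast, smul_eq_mul, ← mul_assoc,
    ENNReal.mul_inv_cancel (by simpa using hN) (by simp), one_mul]

theorem sum_lintegral_Ico_comp_div {N : ℕ} (hN : N ≠ 0) (f : ℝ → ℝ≥0∞) :
    ∑ i ∈ Finset.range N, ∫⁻ a in Set.Ico (0 : ℝ) 1, f ((i + a) / N) =
      N * ∫⁻ t in Set.Ico (0 : ℝ) 1, f t := by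
  have hN' : (0 : ℝ) < N := by positivity
  have key : ∀ k : ℕ, ∑ i ∈ Finset.range k, ∫⁻ a in Set.Ico (0 : ℝ) 1, f ((i + a) / N) =
      N * ∫⁻ t in Set.Ico (0 : ℝ) (k / N), f t := by
    intro k
    induction k with
    | zero => simp
    | succ k ih =>
      have h1 : (0 : ℝ) ≤ k / N := by positivity
      have h2 : (k : ℝ) / N ≤ ((k + 1 : ℕ) : ℝ) / N := by gcongr; simp
      rw [Finset.sum_range_succ, ih, lintegral_Ico_comp_div hN, ← mul_add,
        ← Set.Ico_union_Ico_eq_Ico h1 h2, lintegral_union measurableSet_Ico, Nat.cast_succ]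
      exact Set.Ico_disjoint_Ico_same
  rw [key, div_self hN'.ne']

theorem sum_lintegral_μT_comp_div {N : ℕ} (hN : N ≠ 0) {f : ℝ × ℝ → ℝ≥0∞} (hf : Measurable f) :
    ∑ i ∈ Finset.range N, ∑ j ∈ Finset.range N,
      ∫⁻ a, f ((i + a.1) / N, (j + a.2) / N) ∂μT = N * (N * ∫⁻ x, f x ∂μT) := by
  simp_rw [μT_eq_prod]
  have h1 : ∀ i j : ℕ, ∫⁻ a, f ((i + a.1) / N, (j + a.2) / N)
      ∂(volume.restrict (Set.Ico (0 : ℝ) 1)).prod (volume.restrict (Set.Ico (0 : ℝ) 1)) =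
      ∫⁻ a in Set.Ico (0 : ℝ) 1, ∫⁻ b in Set.Ico (0 : ℝ) 1, f ((i + a) / N, (j + b) / N) :=
    fun i j => lintegral_prod _ (by fun_prop)
  have h2 : ∀ i : ℕ, ∑ j ∈ Finset.range N,
      ∫⁻ a in Set.Ico (0 : ℝ) 1, ∫⁻ b in Set.Ico (0 : ℝ) 1, f ((i + a) / N, (j + b) / N) =
      ∫⁻ a in Set.Ico (0 : ℝ) 1, N * ∫⁻ b in Set.Ico (0 : ℝ) 1, f ((i + a) / N, b) := fun i => by
    have hm : ∀ j : ℕ, Measurable fun a : ℝ =>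
        ∫⁻ b in Set.Ico (0 : ℝ) 1, f ((i + a) / N, (j + b) / N) := fun j =>
      Measurable.lintegral_prod_right' (f := fun p : ℝ × ℝ => f ((i + p.1) / N, (j + p.2) / N))
        (by fun_prop)
    rw [← lintegral_finsetSum _ fun j _ => hm j]
    exact lintegral_congr fun a => sum_lintegral_Ico_comp_div hN fun b => f ((i + a) / N, b)
  simp_rw [h1, h2]
  rw [sum_lintegral_Ico_comp_div hN fun a => N * ∫⁻ b in Set.Ico (0 : ℝ) 1, f (a, b),
    lintegral_const_mul _ hf.lintegral_prod_right', lintegral_prod _ hf.aemeasurable]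

/-! ### Averages along segments and mollification -/

section SegmentAverage

variable {E : Type*} [NormedAddCommGroup E] [NormedSpace ℝ E] [FiniteDimensional ℝ E]

theorem hasFDerivAt_intervalIntegral_comp_sub_smul {ψ : E → ℝ} (hψ : ContDiff ℝ 1 ψ) (e : E)
    (h : ℝ) (x : E) :
    HasFDerivAt (fun x => ∫ s in (0 : ℝ)..h, ψ (x - s • e))
      (∫ s in (0 : ℝ)..h, fderiv ℝ ψ (x - s • e)) x := by
  have hc : Continuous fun p : E × ℝ => fderiv ℝ ψ (p.1 - p.2 • e) :=
    (hψ.continuous_fderiv one_ne_zero).comp (by fun_prop)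
  obtain ⟨C, hC⟩ := ((isCompact_closedBall x 1).prod
    (isCompact_uIcc (a := (0 : ℝ)) (b := h))).exists_bound_of_continuousOn hc.continuousOn
  refine intervalIntegral.hasFDerivAt_integral_of_dominated_of_fderiv_le (bound := fun _ => C)
    (F' := fun x s => fderiv ℝ ψ (x - s • e)) (Metric.closedBall_mem_nhds x one_pos)
    (Eventually.of_forall fun y => ?_) ?_ ?_ ?_ (by simp) ?_
  · exact (hψ.continuous.comp (by fun_prop : Continuous fun s : ℝ => y - s • e)).aestronglyMeasurable
  · exact (hψ.continuous.comp
      (by fun_prop : Continuous fun s : ℝ => x - s • e)).intervalIntegrable _ _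
  · exact (hc.comp (by fun_prop : Continuous fun s : ℝ => (x, s))).aestronglyMeasurable
  · exact Eventually.of_forall fun t ht y hy => hC (y, t) ⟨hy, Set.uIoc_subset_uIcc ht⟩
  · refine Eventually.of_forall fun t _ y _ => ?_
    have h1 := (hψ.differentiable one_ne_zero (y - t • e)).hasFDerivAt
    exact h1.comp y ((hasFDerivAt_id y).sub_const (t • e))

theorem contDiff_intervalIntegral_comp_sub_smul {ψ : E → ℝ} (hψ : ContDiff ℝ 1 ψ) (e : E) (h : ℝ) :
    ContDiff ℝ 1 fun x => ∫ s in (0 : ℝ)..h, ψ (x - s • e) := by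
  have hd := hasFDerivAt_intervalIntegral_comp_sub_smul hψ e h
  refine contDiff_one_iff_fderiv.2 ⟨fun x => (hd x).differentiableAt, ?_⟩
  rw [funext fun x => (hd x).fderiv]
  have hc : Continuous (Function.uncurry fun (x : E) (s : ℝ) => fderiv ℝ ψ (x - s • e)) :=
    (hψ.continuous_fderiv one_ne_zero).comp (by fun_prop)
  exact intervalIntegral.continuous_parametric_intervalIntegral_of_continuous' hc 0 h

theorem fderiv_intervalIntegral_comp_sub_smul {ψ : E → ℝ} (hψ : ContDiff ℝ 1 ψ) (e : E) (h : ℝ)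
    (x : E) : fderiv ℝ (fun x => ∫ s in (0 : ℝ)..h, ψ (x - s • e)) x e = ψ x - ψ (x - h • e) := by
  have hc : Continuous fun s : ℝ => fderiv ℝ ψ (x - s • e) :=
    (hψ.continuous_fderiv one_ne_zero).comp (by fun_prop)
  rw [(hasFDerivAt_intervalIntegral_comp_sub_smul hψ e h x).fderiv,
    ContinuousLinearMap.intervalIntegral_apply (hc.intervalIntegrable _ _)]
  have hd : ∀ s : ℝ, HasDerivAt (fun s : ℝ => -ψ (x - s • e)) (fderiv ℝ ψ (x - s • e) e) s := by
    intro s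
    have h1 := (hψ.differentiable one_ne_zero (x - s • e)).hasFDerivAt
    have h2 := ((hasDerivAt_id s).smul_const e).const_sub x
    exact (h1.comp_hasDerivAt s h2).neg.congr_deriv (by simp)
  rw [intervalIntegral.integral_eq_sub_of_hasDerivAt (fun s _ => hd s)
    ((hc.clm_apply continuous_const).intervalIntegrable _ _)]
  simp; ring

end SegmentAverage

theorem abs_intervalIntegral_inv_mul_le {f : ℝ → ℝ} (hf : ∀ s, |f s| ≤ 1) {h : ℝ} (hh : 0 < h) :
    |h⁻¹ * ∫ s in (0 : ℝ)..h, f s| ≤ 1 := by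
  have := intervalIntegral.norm_integral_le_of_norm_le_const (a := 0) (b := h) (C := 1)
    (f := f) fun s _ => hf s
  rw [Real.norm_eq_abs, sub_zero, abs_of_pos hh, one_mul] at this
  rw [abs_mul, abs_of_pos (inv_pos.2 hh)]
  calc h⁻¹ * _ ≤ h⁻¹ * h := by gcongr
    _ = 1 := inv_mul_cancel₀ (ne_of_gt hh)

/-- A bounded periodic function is approximated almost everywhere by periodic `C¹` functions
obeying the same bound. -/
theorem Periodic2.exists_contDiff_tendsto {f : ℝ × ℝ → ℝ} (hf : Periodic2 f) (hm : Measurable f)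
    (hb : ∀ x, |f x| ≤ 1) :
    ∃ φ : ℕ → ℝ × ℝ → ℝ, (∀ k, ContDiff ℝ 1 (φ k) ∧ Periodic2 (φ k) ∧ ∀ x, |φ k x| ≤ 1) ∧
      ∀ᵐ x ∂μT, Tendsto (fun k => φ k x) atTop (𝓝 (f x)) := by
  have hr : ∀ k : ℕ, (0 : ℝ) < 1 / (k + 1) := fun k => Nat.one_div_pos_of_nat
  let ρ : ℕ → ContDiffBump (0 : ℝ × ℝ) := fun k =>
    ⟨1 / (k + 1), 2 * (1 / (k + 1)), hr k, by linarith [hr k]⟩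
  have hloc : LocallyIntegrable f :=
    (memLp_top_of_bound hm.aestronglyMeasurable 1
      (Eventually.of_forall hb)).locallyIntegrable le_top
  refine ⟨fun k => convolution ((ρ k).normed volume) f (ContinuousLinearMap.lsmul ℝ ℝ) volume,
    fun k => ⟨?_, ?_, ?_⟩, ?_⟩
  · exact (ρ k).hasCompactSupport_normed.contDiff_convolution_left _ (ρ k).contDiff_normed hloc
  · intro x
    simp only [convolution_def]
    constructor <;> congr 1 <;> ext y <;> congr 1
    · exact ((hf (x - y)).1 ▸ by congr 1; ext <;> simp; ring)
    · exact ((hf (x - y)).2 ▸ by congr 1; ext <;> simp; ring)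
  · intro x
    beta_reduce
    rw [convolution_def, ← Real.norm_eq_abs, ← (ρ k).integral_normed (μ := volume)]
    refine norm_integral_le_of_norm_le (ρ k).integrable_normed (Eventually.of_forall fun y => ?_)
    rw [ContinuousLinearMap.lsmul_apply, norm_smul, Real.norm_of_nonneg ((ρ k).nonneg_normed y)]
    exact mul_le_of_le_one_right ((ρ k).nonneg_normed y) (hb _)
  · refine ae_restrict_of_ae ?_
    refine ContDiffBump.ae_convolution_tendsto_right_of_locallyIntegrable (K := 2) ?_
      (Eventually.of_forall fun k => le_rfl) hloc
    simpa [ρ] using (tendsto_one_div_add_atTop_nhds_zero_nat (𝕜 := ℝ)).const_mul 2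

/-! ### Difference quotients are controlled by the anisotropic total variation -/

theorem integrable_μT_of_bound {f : ℝ × ℝ → ℝ} (hm : Measurable f) {C : ℝ} (hb : ∀ x, |f x| ≤ C) :
    Integrable f μT :=
  Integrable.of_bound hm.aestronglyMeasurable C (Eventually.of_forall hb)

theorem Periodic2.integral_mul_comp_sub_sub {w φ : ℝ × ℝ → ℝ} (hw : Periodic2 w)
    (hwm : Measurable w) (hwb : ∀ x, |w x| ≤ 1) (hφ : Periodic2 φ) (hφm : Measurable φ)
    (hφb : ∀ x, |φ x| ≤ 1) (z : ℝ × ℝ) :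
    ∫ x, w x * (φ (x - z) - φ x) ∂μT = ∫ x, (w (x + z) - w x) * φ x ∂μT := by
  have hb : ∀ x y, |w x * φ y| ≤ 1 := fun x y => by
    rw [abs_mul]; exact mul_le_one₀ (hwb x) (abs_nonneg _) (hφb y)
  have hp : Periodic2 fun x => w x * φ (x - z) := fun x => by
    have := hφ.comp_add (-z) x
    simp only [← sub_eq_add_neg] at this
    simp only [(hw x).1, (hw x).2, this, and_self]
  have h := hp.integral_comp_add (by fun_prop) z
  simp only [add_sub_cancel_right] at h
  simp_rw [mul_sub, sub_mul]
  rw [integral_sub, integral_sub, h]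
  · exact integrable_μT_of_bound (by fun_prop) fun x => hb _ _
  · exact integrable_μT_of_bound (by fun_prop) fun x => hb _ _
  · exact integrable_μT_of_bound (by fun_prop) fun x => hb _ _
  · exact integrable_μT_of_bound (by fun_prop) fun x => hb _ _

theorem ofReal_integral_diff_mul_le_anisoTV {w φ₁ φ₂ : ℝ × ℝ → ℝ} (hw : Periodic2 w)
    (hwm : Measurable w) (hwb : ∀ x, |w x| ≤ 1)
    (h₁ : ContDiff ℝ 1 φ₁ ∧ Periodic2 φ₁ ∧ ∀ x, |φ₁ x| ≤ 1)
    (h₂ : ContDiff ℝ 1 φ₂ ∧ Periodic2 φ₂ ∧ ∀ x, |φ₂ x| ≤ 1) {h : ℝ} (hh : 0 < h) :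
    ENNReal.ofReal (h⁻¹ * (∫ x, (w (x + (h, 0)) - w x) * φ₁ x ∂μT +
      ∫ x, (w (x + (0, h)) - w x) * φ₂ x ∂μT)) ≤ anisoTV w := by
  let Φ (φ : ℝ × ℝ → ℝ) (e x : ℝ × ℝ) : ℝ := h⁻¹ * ∫ s in (0 : ℝ)..h, φ (x - s • e)
  have hΦc : ∀ φ e, ContDiff ℝ 1 φ → ContDiff ℝ 1 (Φ φ e) := fun φ e hφ =>
    contDiff_const.mul (contDiff_intervalIntegral_comp_sub_smul hφ e h)
  have hΦp : ∀ φ e, Periodic2 φ → Periodic2 (Φ φ e) := fun φ e hφ x => by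
    have h1 : ∀ s : ℝ, _ := fun s => hφ.comp_add (-(s • e)) x
    simp only [← sub_eq_add_neg] at h1
    simp only [Φ, h1, and_self]
  have hΦb : ∀ φ e, (∀ x, |φ x| ≤ 1) → ∀ x, |Φ φ e x| ≤ 1 := fun φ e hφ x =>
    abs_intervalIntegral_inv_mul_le (fun s => hφ _) hh
  have hΦd : ∀ φ e, ContDiff ℝ 1 φ → ∀ x, fderiv ℝ (Φ φ e) x e = h⁻¹ * (φ x - φ (x - h • e)) :=
    fun φ e hφ x => by
      rw [← fderiv_intervalIntegral_comp_sub_smul hφ e h x]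
      exact congrArg (fun L : ℝ × ℝ →L[ℝ] ℝ => L e) (fderiv_const_mul
        (hasFDerivAt_intervalIntegral_comp_sub_smul hφ e h x).differentiableAt h⁻¹)
  have hc₁ := hΦc φ₁ (1, 0) h₁.1
  have hc₂ := hΦc φ₂ (0, 1) h₂.1
  have hdiv : ∀ x, div2 (fun x => (-Φ φ₁ (1, 0) x, -Φ φ₂ (0, 1) x)) x =
      h⁻¹ * (φ₁ (x - (h, 0)) - φ₁ x) + h⁻¹ * (φ₂ (x - (0, h)) - φ₂ x) := fun x => by
    have hd : fderiv ℝ (fun x => (-Φ φ₁ (1, 0) x, -Φ φ₂ (0, 1) x)) x =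
        (-fderiv ℝ (Φ φ₁ (1, 0)) x).prod (-fderiv ℝ (Φ φ₂ (0, 1)) x) :=
      ((hc₁.differentiable one_ne_zero x).hasFDerivAt.neg.prodMk
        (hc₂.differentiable one_ne_zero x).hasFDerivAt.neg).fderiv
    have e1 := hΦd φ₁ (1, 0) h₁.1 x
    have e2 := hΦd φ₂ (0, 1) h₂.1 x
    simp only [Prod.smul_mk, smul_eq_mul, mul_one, mul_zero] at e1 e2
    simp only [div2, hd, ContinuousLinearMap.prod_apply, neg_apply, e1, e2]
    ring
  have hint : ∀ (φ : ℝ × ℝ → ℝ) (z : ℝ × ℝ), ContDiff ℝ 1 φ → (∀ x, |φ x| ≤ 1) →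
      Integrable (fun x => w x * (φ (x - z) - φ x)) μT := fun φ z hφ hb => by
    have hφm := hφ.continuous.measurable
    refine integrable_μT_of_bound (C := 1 * (1 + 1)) (by fun_prop) fun x => ?_
    rw [abs_mul]
    gcongr
    · exact hwb x
    · exact (abs_sub _ _).trans (add_le_add (hb _) (hb _))
  have key : ∫ x, w x * div2 (fun x => (-Φ φ₁ (1, 0) x, -Φ φ₂ (0, 1) x)) x ∂μT =
      h⁻¹ * (∫ x, (w (x + (h, 0)) - w x) * φ₁ x ∂μT +
      ∫ x, (w (x + (0, h)) - w x) * φ₂ x ∂μT) := by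
    rw [← hw.integral_mul_comp_sub_sub hwm hwb h₁.2.1 h₁.1.continuous.measurable h₁.2.2,
      ← hw.integral_mul_comp_sub_sub hwm hwb h₂.2.1 h₂.1.continuous.measurable h₂.2.2,
      ← integral_add (hint _ _ h₁.1 h₁.2.2) (hint _ _ h₂.1 h₂.2.2), ← integral_const_mul]
    refine integral_congr_ae (Eventually.of_forall fun x => ?_)
    simp only [hdiv]
    ring
  rw [← key]
  refine le_iSup₂_of_le (fun x => (-Φ φ₁ (1, 0) x, -Φ φ₂ (0, 1) x))
    ⟨hc₁.neg.prodMk hc₂.neg, fun x => ?_, fun x => ?_⟩ le_rfl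
  · have p1 := hΦp φ₁ (1, 0) h₁.2.1 x
    have p2 := hΦp φ₂ (0, 1) h₂.2.1 x
    simp only [p1, p2, and_self]
  · simp only [abs_neg]
    exact ⟨hΦb _ _ h₁.2.2 x, hΦb _ _ h₂.2.2 x⟩

/-- The difference quotients of a periodic binary function in the coordinate directions are bounded
by its anisotropic total variation. -/
theorem lintegral_enorm_diff_le_anisoTV {w : ℝ × ℝ → ℝ} (hw : Periodic2 w)
    (hwm : Measurable w) (hw01 : ∀ x, w x = 0 ∨ w x = 1) {h : ℝ} (hh : 0 < h) :
    ∫⁻ x, ‖w (x + (h, 0)) - w x‖ₑ ∂μT + ∫⁻ x, ‖w (x + (0, h)) - w x‖ₑ ∂μT ≤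
      ENNReal.ofReal h * anisoTV w := by
  have hwb : ∀ x, |w x| ≤ 1 := fun x => by rcases hw01 x with h | h <;> simp [h]
  have hDp : ∀ z, Periodic2 fun x => w (x + z) - w x := fun z x => by
    have := hw.comp_add z x
    simp only [this, hw x, and_self]
  have hDm : ∀ z, Measurable fun x => w (x + z) - w x := fun z => by fun_prop
  have hDb : ∀ z x, |w (x + z) - w x| ≤ 1 := fun z x => by
    rcases hw01 x with h | h <;> rcases hw01 (x + z) with h' | h' <;> simp [h, h']
  have hDsq : ∀ z, ENNReal.ofReal (∫ x, (w (x + z) - w x) * (w (x + z) - w x) ∂μT) =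
      ∫⁻ x, ‖w (x + z) - w x‖ₑ ∂μT := fun z => by
    rw [ofReal_integral_eq_lintegral_ofReal]
    · refine lintegral_congr fun x => ?_
      rcases hw01 x with h | h <;> rcases hw01 (x + z) with h' | h' <;> simp [h, h']
    · refine integrable_μT_of_bound (C := 1) (by fun_prop) fun x => ?_
      rw [abs_mul]; exact mul_le_one₀ (hDb _ _) (abs_nonneg _) (hDb _ _)
    · exact Eventually.of_forall fun x => mul_self_nonneg _
  obtain ⟨φ, hφ, hφt⟩ := (hDp (h, 0)).exists_contDiff_tendsto (hDm _) (hDb _)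
  obtain ⟨χ, hχ, hχt⟩ := (hDp (0, h)).exists_contDiff_tendsto (hDm _) (hDb _)
  have hlim : ∀ (z : ℝ × ℝ) (φ : ℕ → ℝ × ℝ → ℝ),
      (∀ k, ContDiff ℝ 1 (φ k) ∧ Periodic2 (φ k) ∧ ∀ x, |φ k x| ≤ 1) →
      (∀ᵐ x ∂μT, Tendsto (fun k => φ k x) atTop (𝓝 (w (x + z) - w x))) →
      Tendsto (fun k => ∫ x, (w (x + z) - w x) * φ k x ∂μT) atTop
        (𝓝 (∫ x, (w (x + z) - w x) * (w (x + z) - w x) ∂μT)) := fun z φ hφ ht => by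
    refine tendsto_integral_of_dominated_convergence (fun _ => 1) (fun k => ?_)
      (integrable_const _) (fun k => Eventually.of_forall fun x => ?_) ?_
    · exact ((hDm z).mul (hφ k).1.continuous.measurable).aestronglyMeasurable
    · rw [Real.norm_eq_abs, abs_mul]
      exact mul_le_one₀ (hDb _ _) (abs_nonneg _) ((hφ k).2.2 x)
    · filter_upwards [ht] with x hx using hx.const_mul _
  have hle := le_of_tendsto' (ENNReal.tendsto_ofReal
    (((hlim _ φ hφ hφt).add (hlim _ χ hχ hχt)).const_mul h⁻¹))
    fun k => ofReal_integral_diff_mul_le_anisoTV hw hwm hwb (hφ k) (hχ k) hh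
  rw [ENNReal.ofReal_mul (inv_nonneg.2 hh.le), ENNReal.ofReal_add
    (integral_nonneg fun x => mul_self_nonneg _) (integral_nonneg fun x => mul_self_nonneg _),
    hDsq, hDsq, ENNReal.ofReal_inv_of_pos hh, mul_comm, ← div_eq_mul_inv] at hle
  rw [mul_comm]
  exact (ENNReal.div_le_iff (by simpa using hh) ENNReal.ofReal_ne_top).1 hle

theorem lintegral_enorm_sub_comp_neg {w : ℝ × ℝ → ℝ} (hw : Periodic2 w) (hwm : Measurable w)
    (z : ℝ × ℝ) :
    ∫⁻ x, ‖w (x + -z) - w x‖ₑ ∂μT = ∫⁻ x, ‖w (x + z) - w x‖ₑ ∂μT := by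
  have hp : Periodic2 fun x => ‖w (x + -z) - w x‖ₑ := fun x => by
    simp only [hw.comp_add (-z) x, hw x, and_self]
  rw [← hp.lintegral_comp_add (by fun_prop) z]
  simp only [add_neg_cancel_right, enorm_sub_rev]

/-- The `L¹` modulus of continuity of a periodic binary function of bounded variation. -/
theorem lintegral_enorm_translate_sub_le {w : ℝ × ℝ → ℝ} (hw : Periodic2 w)
    (hwm : Measurable w) (hw01 : ∀ x, w x = 0 ∨ w x = 1) (z : ℝ × ℝ) :
    ∫⁻ x, ‖w (x + z) - w x‖ₑ ∂μT ≤ ENNReal.ofReal (|z.1| + |z.2|) * anisoTV w := by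
  have h₁ : ∀ t : ℝ, ∫⁻ x, ‖w (x + (t, 0)) - w x‖ₑ ∂μT ≤ ENNReal.ofReal |t| * anisoTV w := by
    intro t
    rcases lt_trichotomy t 0 with ht | rfl | ht
    · rw [abs_of_neg ht, ← lintegral_enorm_sub_comp_neg hw hwm, Prod.neg_mk, neg_zero]
      exact le_self_add.trans (lintegral_enorm_diff_le_anisoTV hw hwm hw01 (neg_pos.2 ht))
    · simp [← Prod.zero_eq_mk]
    · rw [abs_of_pos ht]
      exact le_self_add.trans (lintegral_enorm_diff_le_anisoTV hw hwm hw01 ht)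
  have h₂ : ∀ t : ℝ, ∫⁻ x, ‖w (x + (0, t)) - w x‖ₑ ∂μT ≤ ENNReal.ofReal |t| * anisoTV w := by
    intro t
    rcases lt_trichotomy t 0 with ht | rfl | ht
    · rw [abs_of_neg ht, ← lintegral_enorm_sub_comp_neg hw hwm, Prod.neg_mk, neg_zero]
      exact le_add_self.trans (lintegral_enorm_diff_le_anisoTV hw hwm hw01 (neg_pos.2 ht))
    · simp [← Prod.zero_eq_mk]
    · rw [abs_of_pos ht]
      exact le_add_self.trans (lintegral_enorm_diff_le_anisoTV hw hwm hw01 ht)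
  have hp : Periodic2 fun x => ‖w (x + (0, z.2)) - w x‖ₑ := fun x => by
    simp only [hw.comp_add (0, z.2) x, hw x, and_self]
  calc ∫⁻ x, ‖w (x + z) - w x‖ₑ ∂μT
      ≤ ∫⁻ x, (‖w (x + (z.1, 0) + (0, z.2)) - w (x + (z.1, 0))‖ₑ +
          ‖w (x + (z.1, 0)) - w x‖ₑ) ∂μT := by
        refine lintegral_mono fun x => ?_
        have : x + z = x + (z.1, 0) + (0, z.2) := by ext <;> simp
        rw [this]
        exact (congrArg enorm (sub_add_sub_cancel _ _ _)).symm.trans_le (enorm_add_le _ _)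
    _ = ∫⁻ x, ‖w (x + (0, z.2)) - w x‖ₑ ∂μT + ∫⁻ x, ‖w (x + (z.1, 0)) - w x‖ₑ ∂μT := by
        rw [lintegral_add_left (by fun_prop), hp.lintegral_comp_add (by fun_prop) (z.1, 0)]
    _ ≤ ENNReal.ofReal |z.2| * anisoTV w + ENNReal.ofReal |z.1| * anisoTV w :=
        add_le_add (h₂ _) (h₁ _)
    _ = ENNReal.ofReal (|z.1| + |z.2|) * anisoTV w := by
        rw [ENNReal.ofReal_add (abs_nonneg _) (abs_nonneg _), add_mul, add_comm]

/-! ### Sampling on a randomly shifted grid -/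

/-- The values of `w` on the `N × N` grid shifted by `a / N`. -/
def sampleGrid (w : ℝ × ℝ → ℝ) (N : ℕ) (a : ℝ × ℝ) (i j : ℕ) : ℝ :=
  w ((i + a.1) / N, (j + a.2) / N)

theorem measurable_gridIdx (N : ℕ) : Measurable (gridIdx N) :=
  (measurable_of_countable Int.toNat).comp
    (Int.measurable_floor.comp (measurable_fract.mul_const _))

theorem measurable_extendGrid (N : ℕ) (g : ℕ → ℕ → ℝ) : Measurable (extendGrid N g) :=
  (measurable_of_countable fun p : ℕ × ℕ => g p.1 p.2).comp
    (((measurable_gridIdx N).comp measurable_fst).prodMk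
      ((measurable_gridIdx N).comp measurable_snd))

theorem measurable_extendGrid_sampleGrid {w : ℝ × ℝ → ℝ} (hwm : Measurable w) (N : ℕ) :
    Measurable fun p : (ℝ × ℝ) × (ℝ × ℝ) => extendGrid N (sampleGrid w N p.1) p.2 := by
  have h : Measurable fun t : ℝ => (gridIdx N t : ℝ) :=
    (measurable_of_countable (Nat.cast : ℕ → ℝ)).comp (measurable_gridIdx N)
  have h₁ : Measurable fun p : (ℝ × ℝ) × (ℝ × ℝ) => (gridIdx N p.2.1 : ℝ) :=
    h.comp (measurable_fst.comp measurable_snd)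
  have h₂ : Measurable fun p : (ℝ × ℝ) × (ℝ × ℝ) => (gridIdx N p.2.2 : ℝ) :=
    h.comp (measurable_snd.comp measurable_snd)
  exact hwm.comp (((h₁.add (by fun_prop : Measurable fun p : (ℝ × ℝ) × (ℝ × ℝ) => p.1.1)).div_const
    (N : ℝ)).prodMk ((h₂.add (by fun_prop :
      Measurable fun p : (ℝ × ℝ) × (ℝ × ℝ) => p.1.2)).div_const (N : ℝ)))

theorem gridIdx_add_div {N : ℕ} (hN : N ≠ 0) {t : ℝ} (ht : t ∈ Set.Ico (0 : ℝ) 1) (a : ℝ) :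
    (gridIdx N t + a) / N = t + (a - Int.fract (t * N)) / N := by
  have h1 : ((gridIdx N t : ℕ) : ℝ) = ⌊t * N⌋ := by
    have h0 : 0 ≤ ⌊t * N⌋ := Int.floor_nonneg.2 (mul_nonneg ht.1 N.cast_nonneg)
    rw [gridIdx, Int.fract_eq_self.2 ht]
    exact_mod_cast Int.toNat_of_nonneg h0
  have hN' : (N : ℝ) ≠ 0 := by exact_mod_cast hN
  rw [h1, ← Int.self_sub_fract]
  field_simp
  ring

theorem lintegral_Q2_comp_sub_le (H : ℝ × ℝ → ℝ≥0∞) {r : ℝ × ℝ} (hr : r ∈ Q2) :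
    ∫⁻ a, H (a - r) ∂μT ≤
      ∫⁻ s in Set.Icc (-1 : ℝ) 1 ×ˢ Set.Icc (-1 : ℝ) 1, H s := by
  have hK : MeasurableSet (Set.Icc (-1 : ℝ) 1 ×ˢ Set.Icc (-1 : ℝ) 1) :=
    measurableSet_Icc.prod measurableSet_Icc
  rw [← lintegral_indicator hK, ← lintegral_sub_right_eq_self (μ := volume) _ r, μT,
    ← lintegral_indicator measurableSet_Q2]
  refine lintegral_mono (Set.indicator_le' (fun a ha => ?_) fun _ _ => zero_le)
  obtain ⟨⟨h1, h2⟩, h3, h4⟩ := ha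
  obtain ⟨⟨h5, h6⟩, h7, h8⟩ := hr
  rw [Set.indicator_of_mem]
  refine ⟨⟨?_, ?_⟩, ?_, ?_⟩ <;> simp only [Prod.fst_sub, Prod.snd_sub] <;> linarith

theorem lintegral_sampling_error_le {w : ℝ × ℝ → ℝ} (hw : Periodic2 w)
    (hwm : Measurable w) (hw01 : ∀ x, w x = 0 ∨ w x = 1) {N : ℕ} (hN : N ≠ 0) :
    ∫⁻ a, ∫⁻ x, ‖extendGrid N (sampleGrid w N a) x - w x‖ₑ ∂μT ∂μT ≤
      8 * ((N : ℝ≥0∞)⁻¹ * anisoTV w) := by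
  have hN' : (0 : ℝ) < N := by positivity
  let K : Set (ℝ × ℝ) := Set.Icc (-1 : ℝ) 1 ×ˢ Set.Icc (-1 : ℝ) 1
  have hKm : MeasurableSet K := measurableSet_Icc.prod measurableSet_Icc
  have hKv : volume K = 4 := by
    simp only [K, Measure.volume_eq_prod, Measure.prod_prod, Real.volume_Icc]
    rw [← ENNReal.ofReal_mul (by norm_num)]; norm_num
  have hms := measurable_extendGrid_sampleGrid hwm N
  calc ∫⁻ a, ∫⁻ x, ‖extendGrid N (sampleGrid w N a) x - w x‖ₑ ∂μT ∂μT
      = ∫⁻ x, ∫⁻ a, ‖extendGrid N (sampleGrid w N a) x - w x‖ₑ ∂μT ∂μT :=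
        lintegral_lintegral_swap (hms.sub (hwm.comp measurable_snd)).enorm.aemeasurable
    _ ≤ ∫⁻ x, (∫⁻ s in K, ‖w (x + (N : ℝ)⁻¹ • s) - w x‖ₑ) ∂μT := by
        refine lintegral_mono_ae ?_
        filter_upwards [ae_restrict_mem measurableSet_Q2] with x hx
        have hr : (Int.fract (x.1 * N), Int.fract (x.2 * N)) ∈ Q2 :=
          ⟨⟨Int.fract_nonneg _, Int.fract_lt_one _⟩, Int.fract_nonneg _, Int.fract_lt_one _⟩
        refine le_of_eq_of_le (lintegral_congr fun a => ?_)
          (lintegral_Q2_comp_sub_le (fun s => ‖w (x + (N : ℝ)⁻¹ • s) - w x‖ₑ) hr)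
        refine congrArg (fun y => ‖w y - w x‖ₑ) (Prod.ext ?_ ?_)
        · exact (gridIdx_add_div hN hx.1 a.1).trans (by simp [div_eq_inv_mul])
        · exact (gridIdx_add_div hN hx.2 a.2).trans (by simp [div_eq_inv_mul])
    _ = ∫⁻ s in K, ∫⁻ x, ‖w (x + (N : ℝ)⁻¹ • s) - w x‖ₑ ∂μT :=
        lintegral_lintegral_swap (f := fun x s => ‖w (x + (N : ℝ)⁻¹ • s) - w x‖ₑ)
          (by unfold Function.uncurry; fun_prop)
    _ ≤ ∫⁻ s in K, 2 * ((N : ℝ≥0∞)⁻¹ * anisoTV w) := by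
        refine setLIntegral_mono' hKm fun s hs => ?_
        refine (lintegral_enorm_translate_sub_le hw hwm hw01 _).trans ?_
        rw [← mul_assoc]
        gcongr
        rw [← ENNReal.ofReal_natCast, ← ENNReal.ofReal_inv_of_pos hN',
          ← ENNReal.ofReal_ofNat 2, ← ENNReal.ofReal_mul zero_le_two]
        refine ENNReal.ofReal_le_ofReal ?_
        have h1 : |s.1| ≤ 1 := abs_le.2 hs.1
        have h2 : |s.2| ≤ 1 := abs_le.2 hs.2
        simp only [Prod.smul_fst, Prod.smul_snd, smul_eq_mul, abs_mul,
          abs_of_pos (inv_pos.2 hN')]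
        rw [← mul_add, mul_comm]
        gcongr
        linarith
    _ = 8 * ((N : ℝ≥0∞)⁻¹ * anisoTV w) := by
        rw [setLIntegral_const, hKv, mul_right_comm]; norm_num

/-- The energy of the sampled grid, as a function of the shift. -/
def sampleEnergy (w : ℝ × ℝ → ℝ) (N : ℕ) (a : ℝ × ℝ) : ℝ≥0∞ :=
  (N : ℝ≥0∞)⁻¹ * ∑ i ∈ Finset.range N, ∑ j ∈ Finset.range N,
    (‖sampleGrid w N a (i + 1) j - sampleGrid w N a i j‖ₑ +
      ‖sampleGrid w N a i (j + 1) - sampleGrid w N a i j‖ₑ)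

theorem measurable_sampleEnergy {w : ℝ × ℝ → ℝ} (hwm : Measurable w) (N : ℕ) :
    Measurable (sampleEnergy w N) := by
  unfold sampleEnergy sampleGrid
  fun_prop

theorem lintegral_sampleEnergy_le {w : ℝ × ℝ → ℝ} (hw : Periodic2 w)
    (hwm : Measurable w) (hw01 : ∀ x, w x = 0 ∨ w x = 1) {N : ℕ} (hN : N ≠ 0) :
    ∫⁻ a, sampleEnergy w N a ∂μT ≤ anisoTV w := by
  have hN' : (0 : ℝ) < N := by positivity
  have hN0 : (N : ℝ≥0∞) ≠ 0 := by exact_mod_cast hN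
  obtain ⟨f, hf_def⟩ : ∃ f : ℝ × ℝ → ℝ≥0∞, f = fun x =>
    ‖w (x + ((N : ℝ)⁻¹, 0)) - w x‖ₑ + ‖w (x + (0, (N : ℝ)⁻¹)) - w x‖ₑ := ⟨_, rfl⟩
  have hf : Measurable f := by rw [hf_def]; fun_prop
  have hfT : ∫⁻ x, f x ∂μT ≤ (N : ℝ≥0∞)⁻¹ * anisoTV w := by
    rw [hf_def, lintegral_add_left (by fun_prop), ← ENNReal.ofReal_natCast,
      ← ENNReal.ofReal_inv_of_pos hN']
    exact lintegral_enorm_diff_le_anisoTV hw hwm hw01 (inv_pos.2 hN')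
  have hE : ∀ a, sampleEnergy w N a = (N : ℝ≥0∞)⁻¹ * ∑ i ∈ Finset.range N, ∑ j ∈ Finset.range N,
      f ((i + a.1) / N, (j + a.2) / N) := fun a => by
    have h : ∀ (i : ℕ) (t : ℝ), ((i + 1 : ℕ) + t) / N = (i + t) / N + (N : ℝ)⁻¹ := fun i t => by
      push_cast; field_simp; ring
    simp only [sampleEnergy, sampleGrid, hf_def, Prod.mk_add_mk, add_zero, h]
  have hfm : ∀ i j : ℕ, Measurable fun a : ℝ × ℝ => f ((i + a.1) / N, (j + a.2) / N) :=
    fun i j => by fun_prop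
  have hfs : ∀ i : ℕ, Measurable fun a : ℝ × ℝ =>
      ∑ j ∈ Finset.range N, f ((i + a.1) / N, (j + a.2) / N) :=
    fun i => Finset.measurable_fun_sum _ fun j _ => hfm i j
  calc ∫⁻ a, sampleEnergy w N a ∂μT
      = (N : ℝ≥0∞)⁻¹ * ∑ i ∈ Finset.range N, ∑ j ∈ Finset.range N,
          ∫⁻ a, f ((i + a.1) / N, (j + a.2) / N) ∂μT := by
        rw [lintegral_congr hE, lintegral_const_mul _ (Finset.measurable_fun_sum _ fun i _ => hfs i),
          lintegral_finsetSum _ fun i _ => hfs i]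
        exact congrArg _ (Finset.sum_congr rfl fun i _ => lintegral_finsetSum _ fun j _ => hfm i j)
    _ = N * ∫⁻ x, f x ∂μT := by
        rw [sum_lintegral_μT_comp_div hN hf, ← mul_assoc, ← mul_assoc,
          ENNReal.inv_mul_cancel hN0 (ENNReal.natCast_ne_top N), one_mul]
    _ ≤ N * ((N : ℝ≥0∞)⁻¹ * anisoTV w) := mul_le_mul_right hfT _
    _ = anisoTV w := by
        rw [← mul_assoc, ENNReal.mul_inv_cancel hN0 (ENNReal.natCast_ne_top N), one_mul]

theorem sampleGrid_mod {w : ℝ × ℝ → ℝ} (hw : Periodic2 w) {N : ℕ} (hN : N ≠ 0) (a : ℝ × ℝ)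
    (i j : ℕ) : sampleGrid w N a (i % N) (j % N) = sampleGrid w N a i j := by
  have hN' : (N : ℝ) ≠ 0 := by exact_mod_cast hN
  have h : ∀ (i : ℕ) (t : ℝ), (i + t) / N = ((i % N : ℕ) + t) / N + ((i / N : ℕ) : ℤ) := fun i t => by
    have : (i : ℝ) = (i % N : ℕ) + N * (i / N : ℕ) := by exact_mod_cast (Nat.mod_add_div i N).symm
    nth_rw 1 [this]
    rw [Int.cast_natCast]
    field_simp
    ring
  rw [sampleGrid, sampleGrid, h i, h j]
  exact (hw.add_intCast (_, _) _ _).symm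

theorem ofReal_hAlphaEnergy_sampleGrid {W : ℝ → ℝ} (hW : DoubleWell W) (α : ℝ) {w : ℝ × ℝ → ℝ}
    (hw : Periodic2 w) (hw01 : ∀ x, w x = 0 ∨ w x = 1) {N : ℕ} (hN : N ≠ 0) (a : ℝ × ℝ) :
    ENNReal.ofReal (hAlphaEnergy W α N (sampleGrid w N a)) = sampleEnergy w N a := by
  have hN' : (0 : ℝ) < N := by positivity
  have hW0 : ∀ i j, W (sampleGrid w N a i j) = 0 := fun i j => (hW.2.2 _).2 (hw01 _)
  have hsq : ∀ i j k l, (sampleGrid w N a i j - sampleGrid w N a k l) ^ 2 =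
      |sampleGrid w N a i j - sampleGrid w N a k l| := fun i j k l => by
    unfold sampleGrid
    rcases hw01 ((i + a.1) / N, (j + a.2) / N) with h | h <;>
    rcases hw01 ((k + a.1) / N, (l + a.2) / N) with h' | h' <;> simp [h, h']
  have hmod₁ : ∀ i, ∀ j ∈ Finset.range N,
      sampleGrid w N a (i % N) j = sampleGrid w N a i j := fun i j hj => by
    rw [← sampleGrid_mod hw hN a i j, Nat.mod_eq_of_lt (Finset.mem_range.1 hj)]
  have hmod₂ : ∀ i ∈ Finset.range N, ∀ j,
      sampleGrid w N a i (j % N) = sampleGrid w N a i j := fun i hi j => by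
    rw [← sampleGrid_mod hw hN a i j, Nat.mod_eq_of_lt (Finset.mem_range.1 hi)]
  simp only [hAlphaEnergy, hW0, Finset.sum_const_zero, mul_zero, add_zero, hsq]
  rw [ENNReal.ofReal_mul (inv_nonneg.2 hN'.le), ENNReal.ofReal_inv_of_pos hN',
    ENNReal.ofReal_natCast, sampleEnergy, ENNReal.ofReal_sum_of_nonneg fun i _ => by positivity]
  congr 1
  refine Finset.sum_congr rfl fun i hi => ?_
  rw [ENNReal.ofReal_sum_of_nonneg fun i _ => by positivity]
  refine Finset.sum_congr rfl fun j hj => ?_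
  rw [hmod₁ _ j hj, hmod₂ i hi, ENNReal.ofReal_add (abs_nonneg _) (abs_nonneg _),
    Real.enorm_eq_ofReal_abs, Real.enorm_eq_ofReal_abs]

/-- For a suitable shift, the sampled function has almost optimal energy and is close to `w`. -/
theorem exists_sample_hNalpha_le {W : ℝ → ℝ} (hW : DoubleWell W) (α : ℝ) {w : ℝ × ℝ → ℝ}
    (hw : Periodic2 w) (hwm : Measurable w) (hw01 : ∀ x, w x = 0 ∨ w x = 1) {N : ℕ} (hN : N ≠ 0) :
    ∃ U : ℝ × ℝ → ℝ, Integrable U μT ∧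
      hNalpha W α N U + ENNReal.ofReal √N * ∫⁻ x, ‖U x - w x‖ₑ ∂μT ≤
        anisoTV w + 8 * (ENNReal.ofReal (√N)⁻¹ * anisoTV w) := by
  have hN' : (0 : ℝ) < N := by positivity
  have hms := measurable_extendGrid_sampleGrid hwm N
  have herr : Measurable fun a => ∫⁻ x, ‖extendGrid N (sampleGrid w N a) x - w x‖ₑ ∂μT :=
    (hms.sub (hwm.comp measurable_snd)).enorm.lintegral_prod_right'
  have hE := measurable_sampleEnergy hwm N
  obtain ⟨a, ha⟩ := exists_le_lintegral (μ := μT) (f := fun a => sampleEnergy w N a +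
    ENNReal.ofReal √N * ∫⁻ x, ‖extendGrid N (sampleGrid w N a) x - w x‖ₑ ∂μT)
    (hE.add (herr.const_mul _)).aemeasurable
  refine ⟨extendGrid N (sampleGrid w N a), ?_, ?_⟩
  · refine integrable_μT_of_bound (C := 1) (measurable_extendGrid N _) fun x => ?_
    unfold extendGrid sampleGrid
    rcases hw01 ((gridIdx N x.1 + a.1) / N, (gridIdx N x.2 + a.2) / N) with h | h <;> simp [h]
  · have hle : hNalpha W α N (extendGrid N (sampleGrid w N a)) ≤ sampleEnergy w N a := by
      rw [← ofReal_hAlphaEnergy_sampleGrid hW α hw hw01 hN]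
      exact iInf₂_le (f := fun g (_ : RepGrid N _ g) => ENNReal.ofReal (hAlphaEnergy W α N g)) _
        (EventuallyEq.refl _ _)
    refine (add_le_add_left hle _).trans (ha.trans ?_)
    rw [lintegral_add_left hE, lintegral_const_mul _ herr]
    refine add_le_add (lintegral_sampleEnergy_le hw hwm hw01 hN)
      ((mul_le_mul_right (lintegral_sampling_error_le hw hwm hw01 hN) _).trans_eq ?_)
    have : ENNReal.ofReal √N * (N : ℝ≥0∞)⁻¹ = ENNReal.ofReal (√N)⁻¹ := by
      rw [← ENNReal.ofReal_natCast, ← ENNReal.ofReal_inv_of_pos hN',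
        ← ENNReal.ofReal_mul (Real.sqrt_nonneg _), ← div_eq_mul_inv, Real.sqrt_div_self]
    rw [← this]
    ring

/-- A function that is binary a.e. on the torus has a periodic binary Borel representative. -/
theorem exists_periodic2_binary_ae_eq {u : ℝ × ℝ → ℝ} (hu : AEStronglyMeasurable u μT)
    (hu01 : ∀ᵐ x ∂μT, u x = 0 ∨ u x = 1) :
    ∃ w : ℝ × ℝ → ℝ, Periodic2 w ∧ Measurable w ∧ (∀ x, w x = 0 ∨ w x = 1) ∧ w =ᵐ[μT] u := by
  let A : Set (ℝ × ℝ) := hu.mk u ⁻¹' {1}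
  have hA : MeasurableSet A := hu.stronglyMeasurable_mk.measurable (measurableSet_singleton 1)
  refine ⟨A.indicator 1 ∘ wrap, periodic2_comp_wrap _,
    (measurable_one.indicator hA).comp measurable_wrap, fun x => ?_, ?_⟩
  · by_cases h : wrap x ∈ A <;> simp [h]
  · filter_upwards [hu01, hu.ae_eq_mk, ae_restrict_mem measurableSet_Q2] with x h01 hmk hx
    rw [Function.comp_apply, wrap_eq_self hx]
    rcases h01 with h | h
    · rw [h, Set.indicator_of_notMem]
      simp [A, ← hmk, h]
    · rw [h, Set.indicator_of_mem, Pi.one_apply]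
      simp [A, ← hmk, h]

theorem anisoTV_congr_ae {u w : ℝ × ℝ → ℝ} (h : u =ᵐ[μT] w) : anisoTV u = anisoTV w := by
  unfold anisoTV
  refine iSup_congr fun v => iSup_congr fun _ => congrArg ENNReal.ofReal (integral_congr_ae ?_)
  filter_upwards [h] with x hx
  rw [hx]

/-- Upper bound (UB) for the simultaneous-scaling Γ-convergence `h_N^α → h_{∞,0}`: for each
`u ∈ L¹(T²)`, `α > 0` and `N_n → ∞` there is a recovery sequence `u_n → u` in `L¹(T²)` with
`limsup_n h_{N_n}^α(u_n) ≤ h_{∞,0}(u)`. -/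
theorem upper_bound_hNalpha (W : ℝ → ℝ) (hW : DoubleWell W) (α : ℝ) (hα : 0 < α)
    (u : ℝ × ℝ → ℝ) (hu : Integrable u μT)
    (Nn : ℕ → ℕ) (hNn : Tendsto Nn atTop atTop) :
    ∃ U : ℕ → ℝ × ℝ → ℝ, (∀ n, Integrable (U n) μT) ∧ TendstoL1 U u ∧
      limsup (fun n => hNalpha W α (Nn n) (U n)) atTop ≤ hInf0 u := by
  by_cases hfin : BV01 u ∧ anisoTV u ≠ ⊤
  swap
  · refine ⟨fun _ => u, fun _ => hu, by simp [TendstoL1], ?_⟩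
    have : hInf0 u = ⊤ := by
      unfold hInf0
      split_ifs with h
      · exact not_not.1 fun h' => hfin ⟨h, h'⟩
      · rfl
    simp [this]
  obtain ⟨hBV, hT⟩ := hfin
  obtain ⟨w, hw, hwm, hw01, hwu⟩ := exists_periodic2_binary_ae_eq hBV.1 hBV.2.1
  have hTw : anisoTV w = anisoTV u := anisoTV_congr_ae hwu
  have hex : ∀ n, ∃ U : ℝ × ℝ → ℝ, Integrable U μT ∧ (Nn n ≠ 0 →
      hNalpha W α (Nn n) U + ENNReal.ofReal √(Nn n) * ∫⁻ x, ‖U x - w x‖ₑ ∂μT ≤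
        anisoTV u + 8 * (ENNReal.ofReal (√(Nn n))⁻¹ * anisoTV u)) := fun n => by
    by_cases hN : Nn n = 0
    · exact ⟨u, hu, fun h => absurd hN h⟩
    · obtain ⟨U, hU, hle⟩ := exists_sample_hNalpha_le hW α hw hwm hw01 hN
      exact ⟨U, hU, fun _ => hTw ▸ hle⟩
  choose U hU hle using hex
  have hne : ∀ᶠ n in atTop, Nn n ≠ 0 := hNn.eventually_ne_atTop 0
  have hsqrt : Tendsto (fun n => ENNReal.ofReal (√(Nn n))⁻¹) atTop (𝓝 0) := by
    rw [← ENNReal.ofReal_zero]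
    exact ENNReal.tendsto_ofReal (tendsto_inv_atTop_zero.comp
      (Real.tendsto_sqrt_atTop.comp (tendsto_natCast_atTop_atTop.comp hNn)))
  have hbound : Tendsto (fun n => anisoTV u + 8 * (ENNReal.ofReal (√(Nn n))⁻¹ * anisoTV u)) atTop
      (𝓝 (anisoTV u)) := by
    have := (ENNReal.Tendsto.const_mul (ENNReal.Tendsto.mul_const hsqrt (Or.inr hT))
      (Or.inr (by simp : (8 : ℝ≥0∞) ≠ ⊤))).const_add (anisoTV u)
    simpa using this
  refine ⟨U, hU, ?_, ?_⟩
  · have hlim := ENNReal.Tendsto.mul hsqrt (Or.inr hT) hbound (Or.inr ENNReal.zero_ne_top)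
    rw [zero_mul] at hlim
    refine tendsto_of_tendsto_of_tendsto_of_le_of_le' tendsto_const_nhds hlim
      (Eventually.of_forall fun _ => zero_le) ?_
    filter_upwards [hne] with n hn
    have hs : (0 : ℝ) < √(Nn n) := by positivity
    have hcongr : ∫⁻ x, ENNReal.ofReal |U n x - u x| ∂μT = ∫⁻ x, ‖U n x - w x‖ₑ ∂μT := by
      refine lintegral_congr_ae ?_
      filter_upwards [hwu] with x hx
      rw [hx, Real.enorm_eq_ofReal_abs]
    have hn' := hle n hn
    rw [ENNReal.ofReal_inv_of_pos hs] at hn' ⊢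
    rw [hcongr, mul_comm, ← div_eq_mul_inv,
      ENNReal.le_div_iff_mul_le (Or.inl (by simpa using hs)) (Or.inl ENNReal.ofReal_ne_top),
      mul_comm]
    exact le_add_self.trans hn'
  · rw [hInf0, if_pos hBV, ← hbound.limsup_eq]
    refine limsup_le_limsup ?_
    filter_upwards [hne] with n hn using le_self_add.trans (hle n hn)

end
end

section
/- Assume W satisfies (W1) with exponent β > 0 and let α > β. Let N_n → ∞ in ℕ and let u_n ∈ L¹(T²) be a sequence for which there is a constant C > 0 such that h_{N_n}^α(u_n) ≤ C for all n. Then there exists a subsequence (u_{n'}) and a function u ∈ BV(T²;{0,1}) such that u_{n'} → u in L¹(T²). -/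
open MeasureTheory Filter Topology ENNReal
open scoped Classical

noncomputable section

section Compactness

variable {X : Type*} [MeasurableSpace X]

/-- If the oscillation of `u` is bounded by `f z + g w`, then so is, in the mean, its distance
to its average. -/
theorem integral_abs_sub_average_le {ν : Measure X} [IsFiniteMeasure ν] {u f g : X → ℝ}
    (hu : Integrable u ν) (hf : Integrable f ν) (hg : Integrable g ν)
    (h : ∀ᵐ z ∂ν, ∀ᵐ w ∂ν, |u z - u w| ≤ f z + g w) :
    ∫ z, |u z - ⨍ w, u w ∂ν| ∂ν ≤ ∫ z, f z ∂ν + ∫ z, g z ∂ν := by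
  rcases eq_or_ne ν 0 with rfl | hν
  · simp
  have hm : 0 < ν.real Set.univ := by
    simpa [measureReal_def, ENNReal.toReal_pos_iff, pos_iff_ne_zero] using hν
  have key : ∀ᵐ z ∂ν, |u z - ⨍ w, u w ∂ν| ≤ f z + (ν.real Set.univ)⁻¹ * ∫ w, g w ∂ν := by
    filter_upwards [h] with z hz
    have h1 : ∫ w, (u z - u w) ∂ν = ν.real Set.univ * (u z - ⨍ w, u w ∂ν) := by
      rw [integral_sub (integrable_const _) hu, integral_const, average_eq, smul_eq_mul,
        smul_eq_mul]
      field_simp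
    have h2 : |∫ w, (u z - u w) ∂ν| ≤ ∫ w, (f z + g w) ∂ν :=
      (abs_integral_le_integral_abs).trans
        (integral_mono_ae ((integrable_const _).sub hu).abs ((integrable_const _).add hg) hz)
    rw [h1, abs_mul, abs_of_pos hm, integral_add (integrable_const _) hg, integral_const,
      smul_eq_mul] at h2
    rw [← mul_le_mul_iff_right₀ hm]
    refine h2.trans (le_of_eq ?_)
    field_simp
  refine (integral_mono_ae (hu.sub (integrable_const _)).abs
    (hf.add (integrable_const _)) key).trans (le_of_eq ?_)
  simp only [Pi.add_apply]
  rw [integral_add hf (integrable_const _), integral_const, smul_eq_mul]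
  field_simp

theorem integral_abs_sub_le_of_oscillation {ν : Measure X} [IsFiniteMeasure ν]
    {u f g u' f' g' : X → ℝ}
    (hu : Integrable u ν) (hf : Integrable f ν) (hg : Integrable g ν)
    (h : ∀ᵐ z ∂ν, ∀ᵐ w ∂ν, |u z - u w| ≤ f z + g w)
    (hu' : Integrable u' ν) (hf' : Integrable f' ν) (hg' : Integrable g' ν)
    (h' : ∀ᵐ z ∂ν, ∀ᵐ w ∂ν, |u' z - u' w| ≤ f' z + g' w) :
    ∫ z, |u z - u' z| ∂ν ≤ (∫ z, f z ∂ν + ∫ z, g z ∂ν) + (∫ z, f' z ∂ν + ∫ z, g' z ∂ν)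
      + |∫ z, u z ∂ν - ∫ z, u' z ∂ν| := by
  rcases eq_or_ne ν 0 with rfl | hν
  · simp
  have hm : 0 < ν.real Set.univ := by
    simpa [measureReal_def, ENNReal.toReal_pos_iff, pos_iff_ne_zero] using hν
  have e1 := integral_abs_sub_average_le hu hf hg h
  have e2 := integral_abs_sub_average_le hu' hf' hg' h'
  set a := ⨍ w, u w ∂ν with ha
  set a' := ⨍ w, u' w ∂ν with ha'
  have e3 : ν.real Set.univ * |a - a'| = |∫ z, u z ∂ν - ∫ z, u' z ∂ν| := by
    rw [ha, ha', average_eq, average_eq, smul_eq_mul, smul_eq_mul, ← mul_sub, abs_mul,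
      abs_of_pos (inv_pos.2 hm)]
    field_simp
  have i1 : Integrable (fun z => |u z - a|) ν := (hu.sub (integrable_const _)).abs
  have i2 : Integrable (fun z => |u' z - a'|) ν := (hu'.sub (integrable_const _)).abs
  have i3 : Integrable (fun _ : X => |a - a'|) ν := integrable_const _
  have : ∫ z, |u z - u' z| ∂ν ≤ ∫ z, (|u z - a| + |u' z - a'| + |a - a'|) ∂ν := by
    refine integral_mono (hu.sub hu').abs ((i1.add i2).add i3) fun z => ?_
    simp only
    rw [abs_sub_comm (u' z)]
    calc |u z - u' z| = |(u z - a) + (a' - u' z) + (a - a')| := by ring_nf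
      _ ≤ _ := abs_add_three _ _ _
  have i12 : Integrable (fun z => |u z - a| + |u' z - a'|) ν := i1.add i2
  rw [integral_add i12 i3, integral_add i1 i2, integral_const, smul_eq_mul, e3] at this
  linarith

/-- A sequence of uniformly bounded functions whose mean oscillation on the cells of finite
partitions is uniformly small has a subsequence that converges in `L¹`. -/
theorem exists_subseq_tendsto_integral_of_oscillation {μ : Measure X} [IsFiniteMeasure μ]
    {κ : Type*} [Countable κ] {u : ℕ → X → ℝ} (hu : ∀ n, Measurable (u n))
    (hb : ∀ n x, |u n x| ≤ 1) {p : ℕ → X → κ} (hp : ∀ M k, MeasurableSet (p M ⁻¹' {k}))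
    {s : ℕ → Finset κ} (hs : ∀ M x, p M x ∈ s M) {ε : ℕ → ℝ} (hε : Tendsto ε atTop (𝓝 0))
    (hosc : ∀ M n, ∃ f g : X → ℝ, Integrable f μ ∧ Integrable g μ ∧
      (∀ z w, p M z = p M w → |u n z - u n w| ≤ f z + g w) ∧
      ∫ z, f z ∂μ + ∫ z, g z ∂μ ≤ ε M) :
    ∃ φ : ℕ → ℕ, StrictMono φ ∧ ∃ v : X → ℝ, Integrable v μ ∧
      Tendsto (fun n => ∫ z, |u (φ n) z - v z| ∂μ) atTop (𝓝 0) := by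
  have hui : ∀ n, Integrable (u n) μ := fun n =>
    Integrable.of_bound (hu n).aestronglyMeasurable 1 (Eventually.of_forall (hb n))
  let a : ℕ → (ℕ × κ) → ℝ := fun n q => ∫ z in p q.1 ⁻¹' {q.2}, u n z ∂μ
  have ha : ∀ n, a n ∈ Set.pi Set.univ
      fun _ : ℕ × κ => Set.Icc (-(μ.real Set.univ)) (μ.real Set.univ) := by
    intro n q _
    refine abs_le.1 ?_
    calc |a n q| ≤ ∫ z in p q.1 ⁻¹' {q.2}, |u n z| ∂μ := abs_integral_le_integral_abs
      _ ≤ ∫ z, |u n z| ∂μ :=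
        setIntegral_le_integral (hui n).abs (Eventually.of_forall fun _ => abs_nonneg _)
      _ ≤ ∫ z, (1 : ℝ) ∂μ := integral_mono (hui n).abs (integrable_const _) (hb n)
      _ = _ := by simp
  obtain ⟨b, -, φ, hφ, hlim⟩ :=
    (isCompact_univ_pi fun _ : ℕ × κ => isCompact_Icc).tendsto_subseq ha
  have hsplit : ∀ M (F : X → ℝ), Integrable F μ →
      ∫ z, F z ∂μ = ∑ k ∈ s M, ∫ z in p M ⁻¹' {k}, F z ∂μ := by
    intro M F hF
    rw [← integral_biUnion_finset _ (fun k _ => hp M k) _ (fun k _ => hF.integrableOn)]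
    · rw [← setIntegral_univ]
      congr 2
      ext z
      simpa using hs M z
    · intro k _ l _ hkl
      exact Disjoint.preimage _ (by simpa using hkl)
  have hest : ∀ M m n, ∫ z, |u m z - u n z| ∂μ ≤
      2 * ε M + ∑ k ∈ s M, |a m (M, k) - a n (M, k)| := by
    intro M m n
    obtain ⟨f, g, hf, hg, h, hle⟩ := hosc M m
    obtain ⟨f', g', hf', hg', h', hle'⟩ := hosc M n
    have : ∫ z, |u m z - u n z| ∂μ ≤ (∫ z, f z ∂μ + ∫ z, g z ∂μ) + (∫ z, f' z ∂μ + ∫ z, g' z ∂μ)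
        + ∑ k ∈ s M, |a m (M, k) - a n (M, k)| := by
      rw [hsplit M (fun z => |u m z - u n z|) ((hui m).sub (hui n)).abs, hsplit M f hf,
        hsplit M g hg, hsplit M f' hf', hsplit M g' hg', ← Finset.sum_add_distrib, ← Finset.sum_add_distrib,
        ← Finset.sum_add_distrib, ← Finset.sum_add_distrib]
      refine Finset.sum_le_sum fun k _ => ?_
      have hosc_cell : ∀ {w f g : X → ℝ}, (∀ z y, p M z = p M y → |w z - w y| ≤ f z + g y) →
          ∀ᵐ z ∂(μ.restrict (p M ⁻¹' {k})), ∀ᵐ y ∂(μ.restrict (p M ⁻¹' {k})),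
            |w z - w y| ≤ f z + g y := by
        intro w f g hw
        filter_upwards [ae_restrict_mem (hp M k)] with z hz
        filter_upwards [ae_restrict_mem (hp M k)] with y hy
        exact hw z y (hz.trans hy.symm)
      exact integral_abs_sub_le_of_oscillation (hui m).restrict hf.restrict hg.restrict
        (hosc_cell h) (hui n).restrict hf'.restrict hg'.restrict (hosc_cell h')
    linarith
  have hcauchy : CauchySeq fun n => (hui (φ n)).toL1 (u (φ n)) := by
    rw [Metric.cauchySeq_iff]
    intro δ hδ
    obtain ⟨M, hM⟩ := (hε.eventually (gt_mem_nhds (show (0 : ℝ) < δ / 4 by positivity))).exists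
    have hsum : CauchySeq fun n => fun k : s M => a (φ n) (M, k) :=
      (tendsto_pi_nhds.2 fun k : s M => tendsto_pi_nhds.1 hlim (M, k)).cauchySeq
    obtain ⟨n₀, hn₀⟩ := Metric.cauchySeq_iff.1 hsum (δ / (2 * ((s M).card + 1))) (by positivity)
    refine ⟨n₀, fun m hm n hn => ?_⟩
    rw [dist_eq_norm, ← Integrable.toL1_sub, L1.norm_of_fun_eq_integral_norm]
    have h1 := hest M (φ m) (φ n)
    have h2 : ∑ k ∈ s M, |a (φ m) (M, k) - a (φ n) (M, k)| ≤
        (s M).card • (δ / (2 * ((s M).card + 1))) := by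
      refine Finset.sum_le_card_nsmul _ _ _ fun k hk => ?_
      exact (dist_le_pi_dist (fun k : s M => a (φ m) (M, k)) (fun k : s M => a (φ n) (M, k))
        ⟨k, hk⟩).trans (hn₀ m hm n hn).le
    have h3 : (s M).card • (δ / (2 * ((s M).card + 1))) ≤ δ / 2 := by
      rw [nsmul_eq_mul, mul_div_assoc', div_le_div_iff₀ (by positivity) (by positivity)]
      nlinarith
    simp only [Pi.sub_apply, Real.norm_eq_abs]
    linarith
  obtain ⟨v, hv⟩ := cauchySeq_tendsto_of_complete hcauchy
  refine ⟨φ, hφ, v, L1.integrable_coeFn v, ?_⟩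
  rw [tendsto_iff_norm_sub_tendsto_zero] at hv
  refine hv.congr fun n => ?_
  rw [L1.norm_eq_integral_norm]
  refine integral_congr_ae ?_
  filter_upwards [Lp.coeFn_sub ((hui (φ n)).toL1 (u (φ n))) v,
    (hui (φ n)).coeFn_toL1] with z h1 h2
  rw [h1, Pi.sub_apply, h2, Real.norm_eq_abs]

end Compactness

section Grid

theorem gridIdx_le (N : ℕ) (t : ℝ) : (gridIdx N t : ℝ) ≤ Int.fract t * N :=
  Nat.floor_le (mul_nonneg (Int.fract_nonneg t) N.cast_nonneg)

theorem lt_gridIdx_add_one (N : ℕ) (t : ℝ) : Int.fract t * N < gridIdx N t + 1 :=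
  Nat.lt_floor_add_one _

theorem gridIdx_lt {N : ℕ} (hN : 0 < N) (t : ℝ) : gridIdx N t < N := by
  have h1 := gridIdx_le N t
  have h2 := Int.fract_lt_one t
  have h3 : (0 : ℝ) < N := by exact_mod_cast hN
  have : (gridIdx N t : ℝ) < N := by nlinarith
  exact_mod_cast this

theorem gridIdx_eq_of_mem {N i : ℕ} (hi : i < N) {t : ℝ}
    (ht : t ∈ Set.Ico ((i : ℝ) / N) (((i + 1 : ℕ) : ℝ) / N)) : gridIdx N t = i := by
  have hN : (0 : ℝ) < N := by exact_mod_cast (Nat.zero_le i).trans_lt hi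
  have hi' : ((i + 1 : ℕ) : ℝ) ≤ N := by exact_mod_cast hi
  have h0 : 0 ≤ t := le_trans (by positivity) ht.1
  have h1 : t < 1 := ht.2.trans_le ((div_le_one hN).2 hi')
  change ⌊Int.fract t * N⌋₊ = i
  rw [Int.fract_eq_self.2 ⟨h0, h1⟩, Nat.floor_eq_iff (by positivity)]
  have h2 := (div_le_iff₀ hN).1 ht.1
  have h3 := (lt_div_iff₀ hN).1 ht.2
  push_cast at h3
  exact ⟨h2, h3⟩

theorem abs_gridIdx_le_sum {N : ℕ} (hN : 0 < N) (a : ℕ → ℝ) (t : ℝ) :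
    |a (gridIdx N t)| ≤ ∑ i ∈ Finset.range N, |a i| :=
  Finset.single_le_sum (f := fun i => |a i|) (fun _ _ => abs_nonneg _)
    (Finset.mem_range.2 (gridIdx_lt hN t))

theorem integral_gridIdx_mul {N : ℕ} (hN : 0 < N) (a : ℕ → ℝ) {ψ : ℝ → ℝ}
    (hψ : Continuous ψ) :
    ∫ t in Set.Ico (0 : ℝ) 1, a (gridIdx N t) * ψ t =
      ∑ i ∈ Finset.range N, a i * ∫ t in ((i : ℝ) / N)..(((i + 1 : ℕ) : ℝ) / N), ψ t := by
  have hN' : (N : ℝ) ≠ 0 := by exact_mod_cast hN.ne'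
  have hint : ∀ x y : ℝ, IntervalIntegrable (fun t => a (gridIdx N t) * ψ t) volume x y := by
    intro x y
    rw [intervalIntegrable_iff]
    refine Integrable.bdd_mul (c := ∑ i ∈ Finset.range N, |a i|)
      (intervalIntegrable_iff.1 (hψ.intervalIntegrable x y))
      ((measurable_from_top (f := a)).comp (measurable_gridIdx N)).aestronglyMeasurable
      (Eventually.of_forall fun t => abs_gridIdx_le_sum hN a t)
  have h := intervalIntegral.sum_integral_adjacent_intervals (a := fun i : ℕ => (i : ℝ) / N)
    (n := N) (fun k _ => hint _ _)
  simp only [Nat.cast_zero, zero_div, div_self hN'] at h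
  rw [integral_Ico_eq_integral_Ioc, ← intervalIntegral.integral_of_le zero_le_one, ← h]
  refine Finset.sum_congr rfl fun i hi => ?_
  have hle : (i : ℝ) / N ≤ ((i + 1 : ℕ) : ℝ) / N := by gcongr; simp
  rw [intervalIntegral.integral_of_le hle, intervalIntegral.integral_of_le hle,
    ← integral_Ico_eq_integral_Ioc, ← integral_Ico_eq_integral_Ioc, ← integral_const_mul]
  refine setIntegral_congr_fun measurableSet_Ico fun t ht => ?_
  simp only [gridIdx_eq_of_mem (Finset.mem_range.1 hi) ht]

theorem integral_gridIdx {N : ℕ} (hN : 0 < N) (a : ℕ → ℝ) :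
    ∫ t in Set.Ico (0 : ℝ) 1, a (gridIdx N t) = (N : ℝ)⁻¹ * ∑ i ∈ Finset.range N, a i := by
  have hN' : (N : ℝ) ≠ 0 := by exact_mod_cast hN.ne'
  have h := integral_gridIdx_mul hN a (ψ := fun _ => 1) continuous_const
  simp only [mul_one] at h
  rw [h, Finset.mul_sum]
  refine Finset.sum_congr rfl fun i _ => ?_
  rw [intervalIntegral.integral_const, smul_eq_mul, mul_one, mul_comm]
  congr 1
  push_cast
  field_simp
  ring

theorem sum_mul_sub_eq_of_cyclic {N : ℕ} (a F : ℕ → ℝ) (hF : F N = F 0) :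
    ∑ i ∈ Finset.range N, a i * (F (i + 1) - F i) =
      ∑ i ∈ Finset.range N, (a i - a ((i + 1) % N)) * F (i + 1) := by
  cases N with
  | zero => simp
  | succ n =>
    have key : ∑ i ∈ Finset.range (n + 1), a i * F i =
        ∑ i ∈ Finset.range (n + 1), a ((i + 1) % (n + 1)) * F (i + 1) := by
      rw [Finset.sum_range_succ', Finset.sum_range_succ, Nat.mod_self, hF]
      congr 1
      refine Finset.sum_congr rfl fun i hi => ?_
      rw [Nat.mod_eq_of_lt (by simpa using hi)]
    simp only [mul_sub, sub_mul, Finset.sum_sub_distrib, key]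

theorem integral_gridIdx_mul_deriv_le {N : ℕ} (hN : 0 < N) (a : ℕ → ℝ) {f f' : ℝ → ℝ}
    (hf : ∀ t, HasDerivAt f (f' t) t) (hf' : Continuous f') (hper : f 1 = f 0)
    (hb : ∀ t, |f t| ≤ 1) :
    ∫ t in Set.Ico (0 : ℝ) 1, a (gridIdx N t) * f' t ≤
      ∑ i ∈ Finset.range N, |a ((i + 1) % N) - a i| := by
  have hN' : (N : ℝ) ≠ 0 := by exact_mod_cast hN.ne'
  rw [integral_gridIdx_mul hN a hf']
  simp only [intervalIntegral.integral_eq_sub_of_hasDerivAt (fun t _ => hf t)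
    (hf'.intervalIntegrable _ _)]
  rw [sum_mul_sub_eq_of_cyclic a (fun i => f ((i : ℝ) / N)) (by simp [div_self hN', hper])]
  refine Finset.sum_le_sum fun i _ => (le_abs_self _).trans ?_
  rw [abs_mul, abs_sub_comm]
  exact mul_le_of_le_one_right (abs_nonneg _) (hb _)

instance : IsFiniteMeasure μT := by
  rw [μT_eq_prod]
  infer_instance

theorem measurable_comp_gridIdx (A : ℕ → ℕ → ℝ) (M N : ℕ) :
    Measurable fun z : ℝ × ℝ => A (gridIdx M z.1) (gridIdx N z.2) :=
  (measurable_of_countable fun q : ℕ × ℕ => A q.1 q.2).comp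
    (((measurable_gridIdx M).comp measurable_fst).prodMk
      ((measurable_gridIdx N).comp measurable_snd))

theorem integrable_comp_gridIdx (A : ℕ → ℕ → ℝ) {M N : ℕ} (hM : 0 < M) (hN : 0 < N) :
    Integrable (fun z : ℝ × ℝ => A (gridIdx M z.1) (gridIdx N z.2)) μT := by
  refine Integrable.of_bound (measurable_comp_gridIdx A M N).aestronglyMeasurable
    (∑ K ∈ Finset.range M, ∑ j ∈ Finset.range N, |A K j|) (Eventually.of_forall fun z => ?_)
  exact (abs_gridIdx_le_sum hN (A (gridIdx M z.1)) z.2).trans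
    (Finset.single_le_sum (f := fun K => ∑ j ∈ Finset.range N, |A K j|)
      (fun _ _ => Finset.sum_nonneg fun _ _ => abs_nonneg _)
      (Finset.mem_range.2 (gridIdx_lt hM z.1)))

theorem integral_comp_gridIdx (A : ℕ → ℕ → ℝ) {M N : ℕ} (hM : 0 < M) (hN : 0 < N) :
    ∫ z, A (gridIdx M z.1) (gridIdx N z.2) ∂μT =
      (M : ℝ)⁻¹ * ((N : ℝ)⁻¹ * ∑ K ∈ Finset.range M, ∑ j ∈ Finset.range N, A K j) := by
  have h := integrable_comp_gridIdx A hM hN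
  rw [μT_eq_prod] at h ⊢
  rw [integral_prod _ h]
  simp only [integral_gridIdx hN]
  rw [integral_gridIdx hM (fun K => (N : ℝ)⁻¹ * ∑ j ∈ Finset.range N, A K j), ← Finset.mul_sum]

/-- The variation of the cyclic sequence `h` of length `N` over the indices in the `K`-th of `M`
cells. -/
def cellVar (M N : ℕ) (h : ℕ → ℝ) (K : ℕ) : ℝ :=
  ∑ l ∈ Finset.Ico (K * N / M) ((K + 1) * N / M), |h ((l + 1) % N) - h l|

theorem sum_cellVar {M N : ℕ} (hM : 0 < M) (h : ℕ → ℝ) :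
    ∑ K ∈ Finset.range M, cellVar M N h K =
      ∑ l ∈ Finset.range N, |h ((l + 1) % N) - h l| := by
  have key : ∀ m, ∑ K ∈ Finset.range m, cellVar M N h K =
      ∑ l ∈ Finset.Ico 0 (m * N / M), |h ((l + 1) % N) - h l| := by
    intro m
    induction m with
    | zero => simp
    | succ m ih =>
      rw [Finset.sum_range_succ, ih, cellVar]
      exact Finset.sum_Ico_consecutive _ (Nat.zero_le _)
        (Nat.div_le_div_right (Nat.mul_le_mul_right _ (Nat.le_succ m)))
  rw [key, Nat.mul_div_cancel_left _ hM, Finset.range_eq_Ico]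

theorem gridIdx_mem_cell {M : ℕ} (hM : 0 < M) (N : ℕ) (x : ℝ) :
    gridIdx M x * N / M ≤ gridIdx N x ∧ gridIdx N x ≤ (gridIdx M x + 1) * N / M := by
  have h1 := gridIdx_le M x
  have h2 := lt_gridIdx_add_one M x
  have h3 := gridIdx_le N x
  have h4 := lt_gridIdx_add_one N x
  have hM' : (0 : ℝ) < M := by exact_mod_cast hM
  constructor
  · rw [← Nat.lt_succ_iff, Nat.div_lt_iff_lt_mul hM]
    have : (gridIdx M x : ℝ) * N < (gridIdx N x + 1) * M :=
      calc (gridIdx M x : ℝ) * N ≤ Int.fract x * M * N := by gcongr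
        _ = Int.fract x * N * M := by ring
        _ < _ := by gcongr
    exact_mod_cast this
  · rw [Nat.le_div_iff_mul_le hM]
    have : (gridIdx N x : ℝ) * M ≤ (gridIdx M x + 1) * N :=
      calc (gridIdx N x : ℝ) * M ≤ Int.fract x * N * M := by gcongr
        _ = Int.fract x * M * N := by ring
        _ ≤ _ := by gcongr
    exact_mod_cast this

theorem abs_sub_le_cellVar {M N : ℕ} (hM : 0 < M) (hN : 0 < N) (h : ℕ → ℝ) {x y : ℝ}
    (hxy : gridIdx M x = gridIdx M y) :
    |h (gridIdx N x) - h (gridIdx N y)| ≤ cellVar M N h (gridIdx M x) := by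
  wlog hle : gridIdx N x ≤ gridIdx N y generalizing x y
  · rw [abs_sub_comm, hxy]
    exact this hxy.symm (not_le.1 hle).le
  have h1 := (gridIdx_mem_cell hM N x).1
  have h2 := (gridIdx_mem_cell hM N y).2
  rw [← hxy] at h2
  have h3 := gridIdx_lt hN y
  calc |h (gridIdx N x) - h (gridIdx N y)|
      ≤ ∑ l ∈ Finset.Ico (gridIdx N x) (gridIdx N y), |h l - h (l + 1)| :=
        dist_le_Ico_sum_dist h hle
    _ = ∑ l ∈ Finset.Ico (gridIdx N x) (gridIdx N y), |h ((l + 1) % N) - h l| := by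
        refine Finset.sum_congr rfl fun l hl => ?_
        rw [Finset.mem_Ico] at hl
        rw [Nat.mod_eq_of_lt (by omega), abs_sub_comm]
    _ ≤ _ := Finset.sum_le_sum_of_subset_of_nonneg (Finset.Ico_subset_Ico h1 h2)
        fun _ _ _ => abs_nonneg _

/-- The oscillation of a grid function on the cells of the `M × M` grid is controlled by its
energy. -/
theorem exists_oscillation_bound {M N : ℕ} (hM : 0 < M) (hN : 0 < N) (g : ℕ → ℕ → ℝ) :
    ∃ f f' : ℝ × ℝ → ℝ, Integrable f μT ∧ Integrable f' μT ∧
      (∀ z w : ℝ × ℝ, (gridIdx M z.1, gridIdx M z.2) = (gridIdx M w.1, gridIdx M w.2) →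
        |extendGrid N g z - extendGrid N g w| ≤ f z + f' w) ∧
      ∫ z, f z ∂μT + ∫ z, f' z ∂μT = (M : ℝ)⁻¹ * hEnergy N g := by
  let A : ℕ → ℕ → ℝ := fun K j => cellVar M N (fun i => g i j) K
  let B : ℕ → ℕ → ℝ := fun i L => cellVar M N (fun j => g i j) L
  refine ⟨fun z => A (gridIdx M z.1) (gridIdx N z.2), fun z => B (gridIdx N z.1) (gridIdx M z.2),
    integrable_comp_gridIdx A hM hN, integrable_comp_gridIdx B hN hM, ?_, ?_⟩
  · intro z w hzw
    rw [Prod.mk.injEq] at hzw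
    have h1 := abs_sub_le_cellVar hM hN (fun i => g i (gridIdx N z.2)) hzw.1
    have h2 := abs_sub_le_cellVar hM hN (fun j => g (gridIdx N w.1) j) hzw.2
    rw [hzw.2] at h2
    exact (abs_sub_le _ _ _).trans (add_le_add h1 h2)
  · rw [integral_comp_gridIdx A hM hN, integral_comp_gridIdx B hN hM, Finset.sum_comm]
    simp only [A, B, sum_cellVar hM]
    rw [Finset.sum_comm, hEnergy]
    simp only [Finset.sum_add_distrib]
    ring

end Grid

section TotalVariation

theorem continuous_div2 {v : ℝ × ℝ → ℝ × ℝ} (hv : ContDiff ℝ 1 v) : Continuous (div2 v) := by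
  have h := hv.continuous_fderiv one_ne_zero
  exact ((h.clm_apply continuous_const).fst).add ((h.clm_apply continuous_const).snd)

theorem exists_ae_abs_le_of_continuous {F : ℝ × ℝ → ℝ} (hF : Continuous F) :
    ∃ K : ℝ, ∀ᵐ x ∂μT, |F x| ≤ K := by
  obtain ⟨K, hK⟩ :=
    (isCompact_Icc (a := ((0 : ℝ), (0 : ℝ))) (b := (1, 1))).exists_bound_of_continuousOn
    hF.continuousOn
  refine ⟨K, ?_⟩
  filter_upwards [ae_restrict_mem (μ := volume) (measurableSet_Ico.prod measurableSet_Ico)]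
    with x hx
  exact hK x ⟨⟨hx.1.1, hx.2.1⟩, ⟨hx.1.2.le, hx.2.2.le⟩⟩

theorem integral_extendGrid_mul_le {N : ℕ} (hN : 0 < N) (g : ℕ → ℕ → ℝ)
    {f f' : ℝ × ℝ → ℝ} (hf : ∀ x y, HasDerivAt (fun t => f (t, y)) (f' (x, y)) x)
    (hf' : Continuous f') (hper : ∀ y, f (1, y) = f (0, y)) (hb : ∀ z, |f z| ≤ 1)
    (hint : Integrable (fun z => extendGrid N g z * f' z) μT) :
    ∫ z, extendGrid N g z * f' z ∂μT ≤ (N : ℝ)⁻¹ *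
      ∑ j ∈ Finset.range N, ∑ i ∈ Finset.range N, |g ((i + 1) % N) j - g i j| := by
  rw [μT_eq_prod] at hint ⊢
  rw [integral_prod_symm _ hint,
    ← integral_gridIdx hN (fun j => ∑ i ∈ Finset.range N, |g ((i + 1) % N) j - g i j|)]
  refine integral_mono hint.integral_prod_right ?_ fun y => ?_
  · exact Integrable.of_bound ((measurable_of_countable fun j : ℕ =>
      ∑ i ∈ Finset.range N, |g ((i + 1) % N) j - g i j|).comp
        (measurable_gridIdx N)).aestronglyMeasurable _
      (Eventually.of_forall fun t => abs_gridIdx_le_sum hN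
        (fun j => ∑ i ∈ Finset.range N, |g ((i + 1) % N) j - g i j|) t)
  · exact integral_gridIdx_mul_deriv_le hN (fun i => g i (gridIdx N y)) (fun t => hf t y)
      (hf'.comp (continuous_id.prodMk continuous_const)) (hper y) fun t => hb (t, y)

theorem integral_extendGrid_mul_le' {N : ℕ} (hN : 0 < N) (g : ℕ → ℕ → ℝ)
    {f f' : ℝ × ℝ → ℝ} (hf : ∀ x y, HasDerivAt (fun t => f (x, t)) (f' (x, y)) y)
    (hf' : Continuous f') (hper : ∀ x, f (x, 1) = f (x, 0)) (hb : ∀ z, |f z| ≤ 1)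
    (hint : Integrable (fun z => extendGrid N g z * f' z) μT) :
    ∫ z, extendGrid N g z * f' z ∂μT ≤ (N : ℝ)⁻¹ *
      ∑ i ∈ Finset.range N, ∑ j ∈ Finset.range N, |g i ((j + 1) % N) - g i j| := by
  have hswap : MeasurePreserving Prod.swap μT μT := by
    rw [μT_eq_prod]
    exact Measure.measurePreserving_swap
  have h := integral_extendGrid_mul_le hN (fun i j => g j i) (f := f ∘ Prod.swap)
    (f' := f' ∘ Prod.swap) (fun x y => hf y x) (hf'.comp continuous_swap) hper
    (fun z => hb z.swap) (hswap.integrable_comp_of_integrable hint)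
  rwa [← hswap.integral_comp MeasurableEquiv.prodComm.measurableEmbedding]

theorem integral_extendGrid_mul_div2_le {N : ℕ} (hN : 0 < N) (g : ℕ → ℕ → ℝ)
    {v : ℝ × ℝ → ℝ × ℝ} (hv : ContDiff ℝ 1 v) (hper : Periodic2 v)
    (hb : ∀ x, (v x).1 ^ 2 + (v x).2 ^ 2 ≤ 1) :
    ∫ x, extendGrid N g x * div2 v x ∂μT ≤ hEnergy N g := by
  have hd : ∀ z, HasFDerivAt v (fderiv ℝ v z) z := fun z =>
    (hv.differentiable one_ne_zero z).hasFDerivAt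
  have hc := hv.continuous_fderiv one_ne_zero
  have hc1 : Continuous fun z => (fderiv ℝ v z (1, 0)).1 := (hc.clm_apply continuous_const).fst
  have hc2 : Continuous fun z => (fderiv ℝ v z (0, 1)).2 := (hc.clm_apply continuous_const).snd
  have hint : ∀ {F : ℝ × ℝ → ℝ}, Continuous F →
      Integrable (fun z => extendGrid N g z * F z) μT := by
    intro F hF
    obtain ⟨K, hK⟩ := exists_ae_abs_le_of_continuous hF
    exact (integrable_comp_gridIdx g hN hN).mul_bdd hF.aestronglyMeasurable hK
  have h1 := integral_extendGrid_mul_le hN g (f := fun z => (v z).1)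
    (f' := fun z => (fderiv ℝ v z (1, 0)).1)
    (fun x y => (ContinuousLinearMap.fst ℝ ℝ ℝ).hasFDerivAt.comp_hasDerivAt x
      ((hd (x, y)).comp_hasDerivAt x
      ((hasDerivAt_id x).prodMk (hasDerivAt_const x y)))) hc1
    (fun y => by simpa using congrArg Prod.fst (hper (0, y)).1)
    (fun z => abs_le_one_iff_mul_self_le_one.2 (by nlinarith [hb z, sq_nonneg (v z).2]))
    (hint hc1)
  have h2 := integral_extendGrid_mul_le' hN g (f := fun z => (v z).2)
    (f' := fun z => (fderiv ℝ v z (0, 1)).2)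
    (fun x y => (ContinuousLinearMap.snd ℝ ℝ ℝ).hasFDerivAt.comp_hasDerivAt y
      ((hd (x, y)).comp_hasDerivAt y
      ((hasDerivAt_const y x).prodMk (hasDerivAt_id y)))) hc2
    (fun x => by simpa using congrArg Prod.snd (hper (x, 0)).2)
    (fun z => abs_le_one_iff_mul_self_le_one.2 (by nlinarith [hb z, sq_nonneg (v z).1]))
    (hint hc2)
  simp only [div2, mul_add]
  rw [integral_add (hint hc1) (hint hc2), hEnergy]
  rw [Finset.sum_comm] at h1
  simp only [Finset.sum_add_distrib, mul_add]
  exact add_le_add h1 h2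

/-- The total variation bound passes to `L¹` limits. -/
theorem isoTV_le_of_tendsto {w : ℕ → ℝ × ℝ → ℝ} {u : ℝ × ℝ → ℝ}
    (hw : ∀ n, Integrable (w n) μT) (hu : Integrable u μT)
    (hlim : Tendsto (fun n => ∫ x, |w n x - u x| ∂μT) atTop (𝓝 0)) {E : ℝ}
    (hE : ∀ n (v : ℝ × ℝ → ℝ × ℝ), ContDiff ℝ 1 v → Periodic2 v →
      (∀ x, (v x).1 ^ 2 + (v x).2 ^ 2 ≤ 1) → ∫ x, w n x * div2 v x ∂μT ≤ E) :
    isoTV u ≤ ENNReal.ofReal E := by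
  refine iSup₂_le fun v hv => ENNReal.ofReal_le_ofReal ?_
  obtain ⟨hv, hper, hb⟩ := hv
  obtain ⟨K, hK⟩ := exists_ae_abs_le_of_continuous (continuous_div2 hv)
  have hmul : ∀ {F : ℝ × ℝ → ℝ}, Integrable F μT → Integrable (fun x => F x * div2 v x) μT :=
    fun hF => hF.mul_bdd (continuous_div2 hv).aestronglyMeasurable hK
  have hbound : ∀ n, ∫ x, u x * div2 v x ∂μT ≤ E + (∫ x, |w n x - u x| ∂μT) * K := by
    intro n
    have h1 : ∫ x, u x * div2 v x ∂μT - ∫ x, w n x * div2 v x ∂μT ≤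
        ∫ x, |w n x - u x| * K ∂μT := by
      rw [← integral_sub (hmul hu) (hmul (hw n))]
      refine integral_mono_ae ((hmul hu).sub (hmul (hw n)))
        (((hw n).sub hu).abs.mul_const K) ?_
      filter_upwards [hK] with x hx
      rw [← sub_mul, abs_sub_comm]
      refine (le_abs_self _).trans ?_
      rw [abs_mul]
      gcongr
    rw [integral_mul_const] at h1
    linarith [hE n v hv hper hb]
  have h := (hlim.mul_const K).const_add E
  rw [zero_mul, add_zero] at h
  exact ge_of_tendsto' h hbound

end TotalVariation

section DoubleWell

theorem exists_near_wells {W : ℝ → ℝ} (hW : DoubleWell W) {β : ℝ} (hβ : 0 < β)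
    (hW1 : CondW1 W β) {δ : ℝ} (hδ : 0 < δ) :
    ∃ η > 0, ∀ s, W s < η → |s| < δ ∨ |s - 1| < δ := by
  obtain ⟨a₀, b₀, a₁, b₁, ha₀, hb₀, ha₁, hb₁, hdisj, hout, ⟨c₀, hc₀, h₀⟩, ⟨c₁, hc₁, h₁⟩⟩ := hW1
  have hmem : b₀ / 2 ∈ Set.Ioo a₀ b₀ := ⟨by linarith, by linarith⟩
  have hpos : 0 < W (b₀ / 2) := by
    refine lt_of_le_of_ne (hW.2.1 _) fun h => ?_
    rcases (hW.2.2 _).1 h.symm with h | h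
    · linarith
    · rw [h] at hmem
      exact Set.disjoint_left.1 hdisj hmem ⟨ha₁, hb₁⟩
  have hpow : 0 < δ ^ β := Real.rpow_pos_of_pos hδ β
  have hlt : ∀ {c x y : ℝ}, 0 < c → c * |x| ^ β ≤ y → y < c * δ ^ β → |x| < δ := by
    intro c x y hc h h'
    have := lt_of_mul_lt_mul_left (h.trans_lt h') hc.le
    exact (Real.rpow_lt_rpow_iff (abs_nonneg _) hδ.le hβ).1 this
  refine ⟨min (W (b₀ / 2)) (min (c₀ * δ ^ β) (c₁ * δ ^ β)),
    lt_min hpos (lt_min (by positivity) (by positivity)), fun s hs => ?_⟩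
  rw [lt_min_iff, lt_min_iff] at hs
  by_cases h : s ∈ Set.Ioo a₀ b₀ ∪ Set.Ioo a₁ b₁
  · rcases h with h | h
    · exact Or.inl (hlt hc₀ (h₀ s h) hs.2.1)
    · exact Or.inr (hlt hc₁ (h₁ s h) hs.2.2)
  · exact absurd hs.1 (hout _ (Or.inl hmem) s h).not_gt

/-- Rounding to the nearest well. -/
def roundWell (s : ℝ) : ℝ := if s < 1 / 2 then 0 else 1

theorem roundWell_eq (s : ℝ) : roundWell s = 0 ∨ roundWell s = 1 := by
  unfold roundWell
  split_ifs <;> simp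

theorem abs_roundWell_le (s : ℝ) : |roundWell s| ≤ 1 := by
  rcases roundWell_eq s with h | h <;> simp [h]

theorem abs_sub_roundWell_lt {s δ : ℝ} (hδ : δ ≤ 1 / 4) (h : |s| < δ ∨ |s - 1| < δ) :
    |s - roundWell s| < δ := by
  unfold roundWell
  split_ifs with hs
  · rcases h with h | h
    · simpa using h
    · rw [abs_lt] at h
      linarith
  · rcases h with h | h
    · rw [abs_lt] at h
      linarith
    · exact h

theorem abs_roundWell_sub_le {s t : ℝ} (hs : |s - roundWell s| < 1 / 4)
    (ht : |t - roundWell t| < 1 / 4) :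
    |roundWell s - roundWell t| ≤ 4 * (s - t) ^ 2 := by
  rw [abs_lt] at hs ht
  rcases roundWell_eq s with h | h <;> rcases roundWell_eq t with h' | h' <;>
    rw [h] at hs ⊢ <;> rw [h'] at ht ⊢ <;> norm_num <;> nlinarith

theorem W_lt_of_hAlphaEnergy_lt {W : ℝ → ℝ} (hW : ∀ s, 0 ≤ W s) {α : ℝ} {N : ℕ}
    {g : ℕ → ℕ → ℝ} {D : ℝ} (h : hAlphaEnergy W α N g < D) {i j : ℕ} (hi : i < N) (hj : j < N) :
    (N : ℝ) ^ α * W (g i j) < D := by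
  have hpow : (0 : ℝ) ≤ (N : ℝ) ^ α := Real.rpow_nonneg N.cast_nonneg α
  have h1 : W (g i j) ≤ ∑ i ∈ Finset.range N, ∑ j ∈ Finset.range N, W (g i j) :=
    (Finset.single_le_sum (f := fun j => W (g i j)) (fun _ _ => hW _)
      (Finset.mem_range.2 hj)).trans
      (Finset.single_le_sum (f := fun i => ∑ j ∈ Finset.range N, W (g i j))
        (fun _ _ => Finset.sum_nonneg fun _ _ => hW _) (Finset.mem_range.2 hi))
  have h2 : 0 ≤ (N : ℝ)⁻¹ * ∑ i ∈ Finset.range N, ∑ j ∈ Finset.range N,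
      ((g ((i + 1) % N) j - g i j) ^ 2 + (g i ((j + 1) % N) - g i j) ^ 2) := by
    positivity
  have h3 := mul_le_mul_of_nonneg_left h1 hpow
  unfold hAlphaEnergy at h
  linarith

theorem hEnergy_roundWell_le {W : ℝ → ℝ} (hW : ∀ s, 0 ≤ W s) (α : ℝ) {N : ℕ}
    {g : ℕ → ℕ → ℝ} (h : ∀ i < N, ∀ j < N, |g i j - roundWell (g i j)| < 1 / 4) :
    hEnergy N (fun i j => roundWell (g i j)) ≤ 4 * hAlphaEnergy W α N g := by
  have h1 : hEnergy N (fun i j => roundWell (g i j)) ≤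
      (N : ℝ)⁻¹ * ∑ i ∈ Finset.range N, ∑ j ∈ Finset.range N,
      4 * ((g ((i + 1) % N) j - g i j) ^ 2 + (g i ((j + 1) % N) - g i j) ^ 2) := by
    unfold hEnergy
    gcongr with i hi j hj
    rw [Finset.mem_range] at hi hj
    have hi' := Nat.mod_lt (i + 1) ((Nat.zero_le i).trans_lt hi)
    have hj' := Nat.mod_lt (j + 1) ((Nat.zero_le i).trans_lt hi)
    rw [mul_add]
    exact add_le_add (abs_roundWell_sub_le (h _ hi' _ hj) (h _ hi _ hj))
      (abs_roundWell_sub_le (h _ hi _ hj') (h _ hi _ hj))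
  have h2 : 0 ≤ (N : ℝ) ^ α * ∑ i ∈ Finset.range N, ∑ j ∈ Finset.range N, W (g i j) :=
    mul_nonneg (Real.rpow_nonneg N.cast_nonneg α)
      (Finset.sum_nonneg fun _ _ => Finset.sum_nonneg fun _ _ => hW _)
  simp only [← Finset.mul_sum] at h1
  unfold hAlphaEnergy
  linarith

end DoubleWell

theorem ae_eq_zero_or_one_of_tendsto {X : Type*} [MeasurableSpace X] {μ : Measure X}
    [IsFiniteMeasure μ] {w : ℕ → X → ℝ} {u : X → ℝ} (hw : ∀ n, Integrable (w n) μ)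
    (hu : Integrable u μ) (hlim : Tendsto (fun n => ∫ x, |w n x - u x| ∂μ) atTop (𝓝 0))
    (hbin : ∀ n x, w n x = 0 ∨ w n x = 1) : ∀ᵐ x ∂μ, u x = 0 ∨ u x = 1 := by
  have hi : Integrable (fun x => min |u x| |u x - 1|) μ :=
    hu.abs.inf (hu.sub (integrable_const _)).abs
  have hnn : 0 ≤ fun x => min |u x| |u x - 1| := fun x => le_min (abs_nonneg _) (abs_nonneg _)
  have hle : ∀ n, ∫ x, min |u x| |u x - 1| ∂μ ≤ ∫ x, |w n x - u x| ∂μ := by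
    intro n
    refine integral_mono hi ((hw n).sub hu).abs fun x => ?_
    simp only
    rw [abs_sub_comm (w n x)]
    rcases hbin n x with h | h <;> simp [h]
  have h0 : ∫ x, min |u x| |u x - 1| ∂μ = 0 :=
    le_antisymm (ge_of_tendsto' hlim hle) (integral_nonneg hnn)
  filter_upwards [(integral_eq_zero_iff_of_nonneg hnn hi).1 h0] with x hx
  have hx : min |u x| |u x - 1| = 0 := hx
  rcases min_choice |u x| |u x - 1| with h | h <;> rw [h, abs_eq_zero] at hx
  · exact Or.inl hx
  · exact Or.inr (sub_eq_zero.1 hx)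

/-- Compactness of binary grid functions with bounded cut energy. -/
theorem exists_subseq_of_hEnergy_le {N : ℕ → ℕ} (hN : ∀ n, 0 < N n) {g : ℕ → ℕ → ℕ → ℝ}
    (hg : ∀ n i j, g n i j = 0 ∨ g n i j = 1) {E : ℝ} (hE : ∀ n, hEnergy (N n) (g n) ≤ E) :
    ∃ φ : ℕ → ℕ, StrictMono φ ∧ ∃ u : ℝ × ℝ → ℝ, Integrable u μT ∧ BV01 u ∧
      Tendsto (fun n => ∫ x, |extendGrid (N (φ n)) (g (φ n)) x - u x| ∂μT) atTop (𝓝 0) := by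
  have hint : ∀ n, Integrable (extendGrid (N n) (g n)) μT := fun n =>
    integrable_comp_gridIdx (g n) (hN n) (hN n)
  have hε : Tendsto (fun M : ℕ => ((M + 1 : ℕ) : ℝ)⁻¹ * E) atTop (𝓝 0) := by
    have := ((tendsto_inv_atTop_nhds_zero_nat (𝕜 := ℝ)).comp (tendsto_add_atTop_nat 1)).mul_const E
    rwa [zero_mul] at this
  obtain ⟨φ, hφ, u, hu, hlim⟩ := exists_subseq_tendsto_integral_of_oscillation (μ := μT)
    (u := fun n => extendGrid (N n) (g n))
    (fun n => measurable_comp_gridIdx (g n) (N n) (N n))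
    (fun n x => by rcases hg n (gridIdx (N n) x.1) (gridIdx (N n) x.2) with h | h <;>
      simp [extendGrid, h])
    (p := fun M z => (gridIdx (M + 1) z.1, gridIdx (M + 1) z.2))
    (fun M k => (((measurable_gridIdx _).comp measurable_fst).prodMk
      ((measurable_gridIdx _).comp measurable_snd)) (measurableSet_singleton k))
    (s := fun M => Finset.range (M + 1) ×ˢ Finset.range (M + 1))
    (fun M x => by simpa [-Order.lt_add_one_iff] using
      ⟨gridIdx_lt M.succ_pos x.1, gridIdx_lt M.succ_pos x.2⟩)
    hε (fun M n => by
      obtain ⟨f, f', hf, hf', hosc, heq⟩ := exists_oscillation_bound M.succ_pos (hN n) (g n)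
      refine ⟨f, f', hf, hf', hosc, heq.le.trans ?_⟩
      gcongr
      exact hE n)
  refine ⟨φ, hφ, u, hu, ⟨hu.aestronglyMeasurable, ?_, ?_⟩, hlim⟩
  · exact ae_eq_zero_or_one_of_tendsto (fun n => hint (φ n)) hu hlim fun n x => hg _ _ _
  · exact (isoTV_le_of_tendsto (fun n => hint (φ n)) hu hlim fun n v hv hper hb =>
      (integral_extendGrid_mul_div2_le (hN _) _ hv hper hb).trans (hE _)).trans_lt
        ENNReal.ofReal_lt_top

/-- Compactness for `h_N^α`: under `(W1)` with exponent `β` and `α > β`, a sequence with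
uniformly bounded energy along `N_n → ∞` has a subsequence converging in `L¹(T²)` to some
`u ∈ BV(T²;{0,1})`. -/
theorem compactness_hNalpha (W : ℝ → ℝ) (hW : DoubleWell W)
    (β : ℝ) (hβ : 0 < β) (hW1 : CondW1 W β) (α : ℝ) (hα : β < α)
    (Nn : ℕ → ℕ) (hNn : Tendsto Nn atTop atTop)
    (U : ℕ → ℝ × ℝ → ℝ) (hint : ∀ n, Integrable (U n) μT)
    (C : ℝ) (hC : 0 < C) (hbound : ∀ n, hNalpha W α (Nn n) (U n) ≤ ENNReal.ofReal C) :
    ∃ φ : ℕ → ℕ, StrictMono φ ∧ ∃ u : ℝ × ℝ → ℝ, BV01 u ∧ TendstoL1 (U ∘ φ) u := by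
  have hg : ∀ n, ∃ g, RepGrid (Nn n) (U n) g ∧ hAlphaEnergy W α (Nn n) g < C + 1 := by
    intro n
    have h : hNalpha W α (Nn n) (U n) < ENNReal.ofReal (C + 1) :=
      (hbound n).trans_lt ((ENNReal.ofReal_lt_ofReal_iff (by linarith)).2 (by linarith))
    simp only [hNalpha, iInf_lt_iff] at h
    obtain ⟨g, hg, hlt⟩ := h
    exact ⟨g, hg, (ENNReal.ofReal_lt_ofReal_iff (by linarith)).1 hlt⟩
  choose g hrep hen using hg
  have hround : ∀ δ > 0, δ ≤ 1 / 4 → ∀ᶠ n in atTop, 0 < Nn n ∧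
      ∀ i < Nn n, ∀ j < Nn n, |g n i j - roundWell (g n i j)| < δ := by
    intro δ hδ hδ'
    obtain ⟨η, hη, hnear⟩ := exists_near_wells hW hβ hW1 hδ
    have hpow : Tendsto (fun n => (Nn n : ℝ) ^ α) atTop atTop :=
      (tendsto_rpow_atTop (hβ.trans hα)).comp (tendsto_natCast_atTop_atTop.comp hNn)
    filter_upwards [hpow.eventually_ge_atTop ((C + 1) / η), hNn.eventually_gt_atTop 0]
      with n hn hpos
    refine ⟨hpos, fun i hi j hj => abs_sub_roundWell_lt hδ' (hnear _ ?_)⟩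
    have h := W_lt_of_hAlphaEnergy_lt hW.2.1 (hen n) hi hj
    rw [div_le_iff₀ hη] at hn
    exact lt_of_mul_lt_mul_left (h.trans_le hn) (Real.rpow_nonneg (Nn n).cast_nonneg α)
  let r : ℕ → ℕ → ℕ → ℝ := fun n i j => roundWell (g n i j)
  obtain ⟨n₀, hn₀⟩ := eventually_atTop.1 (hround (1 / 4) (by norm_num) le_rfl)
  obtain ⟨φ, hφ, u, hu, hBV, hlim⟩ := exists_subseq_of_hEnergy_le
    (N := fun n => Nn (n + n₀)) (g := fun n => r (n + n₀)) (E := 4 * (C + 1))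
    (fun n => (hn₀ _ (Nat.le_add_left _ _)).1) (fun n i j => roundWell_eq _)
    (fun n => (hEnergy_roundWell_le hW.2.1 α (hn₀ _ (Nat.le_add_left _ _)).2).trans
      (by linarith [hen (n + n₀)]))
  have hφ' : StrictMono fun n => φ n + n₀ := hφ.add_const n₀
  refine ⟨fun n => φ n + n₀, hφ', u, hBV, ?_⟩
  have hclose : Tendsto (fun n => ∫ x, |U n x - extendGrid (Nn n) (r n) x| ∂μT) atTop (𝓝 0) := by
    rw [Metric.tendsto_nhds]
    intro ε hε
    have hm : 0 < μT.real Set.univ + 1 := by positivity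
    filter_upwards [hround (min (1 / 4) (ε / (μT.real Set.univ + 1) / 2))
      (by positivity) (min_le_left _ _)] with n hn
    have h1 : ∫ x, |U n x - extendGrid (Nn n) (r n) x| ∂μT ≤
        ∫ _, ε / (μT.real Set.univ + 1) / 2 ∂μT := by
      refine integral_mono_ae
        ((hint n).sub (integrable_comp_gridIdx (r n) hn.1 hn.1)).abs (integrable_const _) ?_
      filter_upwards [hrep n] with x hx
      rw [hx]
      exact (hn.2 _ (gridIdx_lt hn.1 _) _ (gridIdx_lt hn.1 _)).le.trans (min_le_right _ _)
    rw [integral_const, smul_eq_mul] at h1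
    rw [dist_zero_right, Real.norm_of_nonneg (integral_nonneg fun _ => abs_nonneg _)]
    refine h1.trans_lt ?_
    rw [div_div, mul_div_assoc', div_lt_iff₀ (by positivity)]
    have : 0 ≤ μT.real Set.univ := measureReal_nonneg
    nlinarith
  have hsum := (hclose.comp hφ'.tendsto_atTop).add hlim
  rw [add_zero] at hsum
  have hreal : Tendsto (fun n => ∫ x, |U (φ n + n₀) x - u x| ∂μT) atTop (𝓝 0) := by
    refine squeeze_zero (fun n => integral_nonneg fun _ => abs_nonneg _) (fun n => ?_) hsum
    have hN := (hn₀ (φ n + n₀) (Nat.le_add_left _ _)).1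
    have hw : Integrable (extendGrid (Nn (φ n + n₀)) (r (φ n + n₀))) μT :=
      integrable_comp_gridIdx _ hN hN
    simp only [Function.comp_apply]
    refine le_of_le_of_eq ?_ (integral_add ((hint _).sub hw).abs (hw.sub hu).abs)
    exact integral_mono ((hint _).sub hu).abs (((hint _).sub hw).abs.add (hw.sub hu).abs)
      fun x => abs_sub_le _ _ _
  have h := ENNReal.tendsto_ofReal hreal
  rw [ENNReal.ofReal_zero] at h
  refine h.congr fun n => ?_
  exact ofReal_integral_eq_lintegral_ofReal ((hint _).sub hu).abs
    (Eventually.of_forall fun _ => abs_nonneg _)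

end
end
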